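/- Fix τ > 0, s ∈ ℂ with Re(s) > 1/2, and an integer N ≥ 2. Then: (i) for every u ∈ D_N, ∫_{v ≺ u} 𝓛(u,v) dv = 1, so that 𝓛 defines a Markov kernel from D_N to D_{N−1}; and (ii) the coherency relation holds: for every bounded continuous function f : D_{N−1} → ℝ, ∫_{D_N} (∫_{D_{N−1}} f(v) 𝓛(u,v) dv) P_N^{τ;s}(du) = ∫_{D_{N−1}} f(v) P_{N−1}^{τ;s}(dv). -/

import Mathlib

/-- The density of the s-measure `P_N^{τ;s}` on the chamber
`D_N = {u₁ > ⋯ > u_N}` (unnormalized). -/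
noncomputable def sDensity (τ : ℝ) (s : ℂ) (N : ℕ) (u : Fin N → ℝ) : ℝ :=
  if ∀ i j : Fin N, i < j → u j < u i then
    (∏ k : Fin N,
      (((1 : ℂ) + (u k : ℂ) * Complex.I) ^ (-s - ((N : ℂ) - 1) * (τ : ℂ)) *
        ((1 : ℂ) - (u k : ℂ) * Complex.I) ^
          (-(starRingEnd ℂ) s - ((N : ℂ) - 1) * (τ : ℂ))).re) *
    ∏ k : Fin N, ∏ l : Fin N, if k < l then (u k - u l) ^ (2 * τ) else 1
  else 0

open MeasureTheory in
/-- The s-measure `P_N^{τ;s}`: the normalized Borel probability measure on `ℝ^N` with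
density proportional to `sDensity τ s N`. -/
noncomputable def sMeasure (τ : ℝ) (s : ℂ) (N : ℕ) : Measure (Fin N → ℝ) :=
  (ENNReal.ofReal (∫ u, sDensity τ s N u))⁻¹ •
    volume.withDensity (fun u => ENNReal.ofReal (sDensity τ s N u))

/-- Interlacement `v ≺ u`: `u_i > v_i > u_{i+1}` for all `i`. -/
def Interlace (n : ℕ) (u : Fin (n + 2) → ℝ) (v : Fin (n + 1) → ℝ) : Prop :=
  ∀ i : Fin (n + 1), v i < u i.castSucc ∧ u i.succ < v i

open scoped Classical in
/-- The Dixon–Anderson kernel `𝓛(u,v)` (with `N = n + 2`). -/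
noncomputable def Lkern (τ : ℝ) (n : ℕ) (u : Fin (n + 2) → ℝ) (v : Fin (n + 1) → ℝ) : ℝ :=
  if Interlace n u v then
    (Real.Gamma ((n + 2 : ℝ) * τ) / Real.Gamma τ ^ (n + 2)) *
    (∏ i : Fin (n + 2), ∏ j : Fin (n + 2), if i < j then (u i - u j) ^ (1 - 2 * τ) else 1) *
    (∏ i : Fin (n + 1), ∏ j : Fin (n + 1), if i < j then (v i - v j) else 1) *
    (∏ i : Fin (n + 1), ∏ j : Fin (n + 2), |v i - u j| ^ (τ - 1))
  else 0

/-- The product `∏_{i<j} (u i - u j)`. -/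
noncomputable def vand {m : ℕ} (u : Fin m → ℝ) : ℝ :=
  ∏ i, ∏ j, if i < j then (u i - u j) else 1

/-- The derivative of `∏ k, (x - u k)` at `x = u j`. -/
noncomputable def nodeDeriv {m : ℕ} (u : Fin (m + 1) → ℝ) (j : Fin (m + 1)) : ℝ :=
  ∏ i : Fin m, (u j - u (j.succAbove i))

theorem vand_pos {m : ℕ} {u : Fin m → ℝ} (hu : StrictAnti u) : 0 < vand u := by
  refine Finset.prod_pos fun i _ => Finset.prod_pos fun j _ => ?_
  split_ifs with h
  · exact sub_pos.2 (hu h)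
  · exact one_pos

theorem prod_rpow_eq_vand_rpow {m : ℕ} {u : Fin m → ℝ} (hu : StrictAnti u) (p : ℝ) :
    (∏ i, ∏ j, if i < j then (u i - u j) ^ p else 1) = vand u ^ p := by
  have key : ∀ i j : Fin m, 0 ≤ if i < j then (u i - u j) else 1 := fun i j => by
    split_ifs with h
    · exact (sub_pos.2 (hu h)).le
    · exact zero_le_one
  rw [vand, ← Real.finsetProd_rpow _ _ fun i _ => Finset.prod_nonneg fun j _ => key i j]
  refine Finset.prod_congr rfl fun i _ => ?_
  rw [← Real.finsetProd_rpow _ _ fun j _ => key i j]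
  refine Finset.prod_congr rfl fun j _ => ?_
  split_ifs <;> simp

theorem prod_erase_eq_prod_succAbove {M : Type*} [CommMonoid M] {m : ℕ} (j : Fin (m + 1))
    (f : Fin (m + 1) → M) :
    ∏ k ∈ Finset.univ.erase j, f k = ∏ i : Fin m, f (j.succAbove i) := by
  rw [← Finset.compl_singleton, ← Fin.image_succAbove_univ,
    Finset.prod_image fun a _ b _ h => Fin.succAbove_right_injective h]

theorem nodeDeriv_ne_zero {m : ℕ} {u : Fin (m + 1) → ℝ} (hu : Function.Injective u)
    (j : Fin (m + 1)) : nodeDeriv u j ≠ 0 :=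
  Finset.prod_ne_zero_iff.2 fun i _ =>
    sub_ne_zero.2 fun h => Fin.succAbove_ne j i (hu h).symm

theorem prod_abs_nodeDeriv {m : ℕ} {u : Fin (m + 1) → ℝ} (hu : StrictAnti u) :
    ∏ j, |nodeDeriv u j| = vand u ^ 2 := by
  have h1 : ∀ j, |nodeDeriv u j| = (∏ k, if j < k then (u j - u k) else 1) *
      ∏ k, if k < j then (u k - u j) else 1 := by
    intro j
    rw [nodeDeriv, ← prod_erase_eq_prod_succAbove j (fun k => u j - u k), Finset.abs_prod,
      ← Finset.prod_mul_distrib, ← Finset.mul_prod_erase Finset.univ _ (Finset.mem_univ j)]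
    simp only [lt_irrefl, if_false, mul_one, one_mul]
    refine Finset.prod_congr rfl fun k hk => ?_
    rcases lt_or_gt_of_ne (Finset.ne_of_mem_erase hk) with h | h
    · simp [h, h.not_gt, abs_of_neg (sub_neg.2 (hu h))]
    · simp [h, h.not_gt, abs_of_pos (sub_pos.2 (hu h))]
  simp_rw [h1, Finset.prod_mul_distrib]
  rw [Finset.prod_comm (f := fun j k => if k < j then (u k - u j) else 1), sq, vand]

theorem neg_one_pow_mul_prod_pos {m : ℕ} (y : Fin m → ℝ) (x : ℝ) (k : ℕ) (hk : k ≤ m)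
    (h1 : ∀ j : Fin m, (j : ℕ) < k → x < y j) (h2 : ∀ j : Fin m, k ≤ (j : ℕ) → y j < x) :
    0 < (-1) ^ k * ∏ j, (x - y j) := by
  have hc : ((-1 : ℝ)) ^ k = ∏ j : Fin m, if (j : ℕ) < k then (-1 : ℝ) else 1 := by
    rw [Finset.prod_ite, Finset.prod_const, Finset.prod_const_one, mul_one]
    simp [Fin.card_filter_val_lt, hk]
  rw [hc, ← Finset.prod_mul_distrib]
  refine Finset.prod_pos fun j _ => ?_
  split_ifs with h
  · linarith [h1 j h]
  · linarith [h2 j (not_lt.1 h)]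

theorem nodeDeriv_sign {m : ℕ} {u : Fin (m + 1) → ℝ} (hu : StrictAnti u) (j : Fin (m + 1)) :
    0 < (-1) ^ (j : ℕ) * nodeDeriv u j := by
  refine neg_one_pow_mul_prod_pos (fun i => u (j.succAbove i)) (u j) j (by omega) ?_ ?_
  · intro i hi
    refine hu ?_
    rw [Fin.succAbove_of_castSucc_lt _ _ (by simpa [Fin.lt_def] using hi)]
    simpa [Fin.lt_def] using hi
  · intro i hi
    refine hu ?_
    rw [Fin.succAbove_of_le_castSucc _ _ (by simpa [Fin.le_def] using hi)]
    rw [Fin.lt_def, Fin.val_succ]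
    omega

theorem exists_interlacing_roots {m : ℕ} {z : Fin (m + 1) → ℝ} (hz : StrictAnti z) {q : ℝ → ℝ}
    (hq : Continuous q) (hs : ∀ k : Fin (m + 1), 0 < (-1) ^ (k : ℕ) * q (z k)) :
    ∃ r : Fin m → ℝ, ∀ k, z k.succ < r k ∧ r k < z k.castSucc ∧ q (r k) = 0 := by
  suffices h : ∀ k : Fin m, ∃ r, z k.succ < r ∧ r < z k.castSucc ∧ q r = 0 by
    choose r hr using h
    exact ⟨r, hr⟩
  intro k
  have hlt : z k.succ < z k.castSucc := hz Fin.castSucc_lt_succ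
  have h1 := hs k.castSucc
  have h2 := hs k.succ
  have hc : ContinuousOn (fun x => (-1) ^ (k : ℕ) * q x) (Set.Icc (z k.succ) (z k.castSucc)) :=
    (hq.const_mul _).continuousOn
  rw [Fin.val_succ, pow_succ] at h2
  rw [Fin.val_castSucc] at h1
  obtain ⟨x, hx, hx0⟩ := intermediate_value_Ioo hlt.le hc
    (show (0 : ℝ) ∈ _ from ⟨by linarith, h1⟩)
  exact ⟨x, hx.1, hx.2, by simpa using hx0⟩

/-- Homogeneous evaluation of a polynomial of degree less than `N` at the point `(x : y)`. -/
noncomputable def homEval (N : ℕ) (q : Polynomial ℝ) (x y : ℝ) : ℝ :=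
  ∑ k : Fin N, x ^ (k : ℕ) * y ^ (k.rev : ℕ) * q.coeff k

theorem homEval_one {N : ℕ} {q : Polynomial ℝ} (hq : q.natDegree < N) (x : ℝ) :
    homEval N q x 1 = q.eval x := by
  rw [Polynomial.eval_eq_sum_range' hq, homEval, ← Fin.sum_univ_eq_sum_range
    (fun i => q.coeff i * x ^ i)]
  exact Finset.sum_congr rfl fun k _ => by simp [mul_comm]

theorem homEval_one_zero (m : ℕ) (q : Polynomial ℝ) : homEval (m + 1) q 1 0 = q.coeff m := by
  rw [homEval, Fin.sum_univ_castSucc, Finset.sum_eq_zero]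
  · simp
  · intro i _
    have : ((i.castSucc).rev : ℕ) ≠ 0 := by
      rw [Fin.val_rev, Fin.val_castSucc]; omega
    rw [zero_pow this, mul_zero, zero_mul]

theorem det_homEval_mul_det_projVandermonde {N : ℕ} (q : Fin N → Polynomial ℝ)
    (x y x' y' : Fin N → ℝ) :
    (Matrix.of fun i j => homEval N (q j) (x i) (y i)).det *
        (Matrix.projVandermonde x' y').det =
      (Matrix.of fun i j => homEval N (q j) (x' i) (y' i)).det *
        (Matrix.projVandermonde x y).det := by
  have h : ∀ x y : Fin N → ℝ, (Matrix.of fun i j => homEval N (q j) (x i) (y i)) =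
      Matrix.projVandermonde x y * Matrix.of fun k j : Fin N => (q j).coeff (k : ℕ) := by
    intro x y
    ext i j
    rw [Matrix.mul_apply]
    rfl
  rw [h, h, Matrix.det_mul, Matrix.det_mul]
  ring

theorem abs_det_projVandermonde_one {N : ℕ} {u : Fin N → ℝ} (hu : StrictAnti u) :
    |(Matrix.projVandermonde u 1).det| = vand u := by
  rw [Matrix.det_projVandermonde, Finset.abs_prod, vand]
  refine Finset.prod_congr rfl fun i _ => ?_
  rw [Finset.abs_prod, ← Finset.prod_filter]
  refine Finset.prod_congr (by ext; simp) fun j hj => ?_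
  have := hu (Finset.mem_filter.1 hj).2
  simp [abs_of_neg (sub_neg.2 this)]

theorem abs_det_projVandermonde_infty {m : ℕ} {v : Fin m → ℝ} (hv : StrictAnti v) :
    |(Matrix.projVandermonde (Fin.cons 1 v : Fin (m + 1) → ℝ) (Fin.cons 0 1)).det| = vand v := by
  rw [← abs_det_projVandermonde_one hv, Matrix.det_projVandermonde, Fin.prod_univ_succ,
    Matrix.det_projVandermonde, abs_mul]
  have : |∏ j ∈ Finset.Ioi (0 : Fin (m + 1)),
      ((Fin.cons 1 v : Fin (m + 1) → ℝ) j * (Fin.cons 0 1 : Fin (m + 1) → ℝ) 0 -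
        (Fin.cons 1 v : Fin (m + 1) → ℝ) 0 * (Fin.cons 0 1 : Fin (m + 1) → ℝ) j)| = 1 := by
    rw [Finset.abs_prod]
    refine Finset.prod_eq_one fun j hj => ?_
    obtain ⟨k, rfl⟩ := Fin.exists_succ_eq.2 (Finset.mem_Ioi.1 hj).ne'
    simp
  rw [this, one_mul]
  congr 1
  refine Finset.prod_congr rfl fun i _ => ?_
  rw [Fin.Ioi_succ]
  simp

open Polynomial in
theorem natDegree_prod_X_sub_C_fin {m : ℕ} (y : Fin m → ℝ) :
    (∏ i, (X - C (y i))).natDegree = m := by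
  simp [natDegree_prod_of_monic _ _ fun i _ => monic_X_sub_C (y i)]

open Polynomial in
theorem coeff_prod_X_sub_C_fin {m : ℕ} (y : Fin m → ℝ) :
    (∏ i, (X - C (y i))).coeff m = 1 := by
  have := (monic_prod_of_monic Finset.univ _ fun i _ => monic_X_sub_C (y i)).coeff_natDegree
  rwa [natDegree_prod_X_sub_C_fin] at this

open Polynomial in
theorem abs_det_infty_rows {m : ℕ} {v : Fin m → ℝ} {u : Fin (m + 1) → ℝ} (hv : StrictAnti v)
    (hu : StrictAnti u) :
    |(Matrix.of fun i j : Fin (m + 1) => (Fin.cons 1 fun i : Fin m => ∏ k, (v i - u (j.succAbove k)) :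
      Fin (m + 1) → ℝ) i).det| = vand u * vand v := by
  have h := congrArg abs (det_homEval_mul_det_projVandermonde
    (fun j => ∏ k : Fin m, (X - C (u (j.succAbove k)))) (Fin.cons 1 v) (Fin.cons 0 1) u 1)
  have hdeg : ∀ j : Fin (m + 1), (∏ k : Fin m, (X - C (u (j.succAbove k)))).natDegree < m + 1 :=
    fun j => by rw [natDegree_prod_X_sub_C_fin]; omega
  have e1 : (Matrix.of fun i j => homEval (m + 1) (∏ k : Fin m, (X - C (u (j.succAbove k)))) (u i)
      ((1 : Fin (m + 1) → ℝ) i)) = Matrix.diagonal (nodeDeriv u) := by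
    ext i j
    rw [Matrix.of_apply, Pi.one_apply, homEval_one (hdeg j), eval_prod]
    simp only [eval_sub, eval_X, eval_C]
    rcases eq_or_ne i j with rfl | hij
    · simp [nodeDeriv]
    · obtain ⟨k, rfl⟩ := Fin.exists_succAbove_eq hij
      rw [Matrix.diagonal_apply_ne _ hij]
      exact Finset.prod_eq_zero (Finset.mem_univ k) (sub_self _)
  have e2 : (Matrix.of fun i j => homEval (m + 1) (∏ k : Fin m, (X - C (u (j.succAbove k))))
      ((Fin.cons 1 v : Fin (m + 1) → ℝ) i) ((Fin.cons 0 1 : Fin (m + 1) → ℝ) i)) =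
      Matrix.of fun i j : Fin (m + 1) => (Fin.cons 1 fun i : Fin m => ∏ k, (v i - u (j.succAbove k)) :
      Fin (m + 1) → ℝ) i := by
    ext i j
    refine Fin.cases ?_ (fun i => ?_) i
    · simp only [Matrix.of_apply, Fin.cons_zero]
      rw [homEval_one_zero, coeff_prod_X_sub_C_fin]
    · simp only [Matrix.of_apply, Fin.cons_succ, Pi.one_apply]
      rw [homEval_one (hdeg j), eval_prod]
      simp
  rw [e1, e2, abs_mul, abs_mul, abs_det_projVandermonde_one hu, abs_det_projVandermonde_infty hv,
    Matrix.det_diagonal, Finset.abs_prod, prod_abs_nodeDeriv hu] at h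
  have := vand_pos hu
  apply mul_right_cancel₀ this.ne'
  linarith

open Polynomial in
theorem abs_det_infty_cols {m : ℕ} {v : Fin (m + 1) → ℝ} {u : Fin (m + 2) → ℝ}
    (hv : StrictAnti v) (hu : StrictAnti u) :
    |(Matrix.of fun j i => (Fin.cons (∏ k, (u j - v k))
      fun i : Fin (m + 1) => ∏ k, (u j - v (i.succAbove k)) : Fin (m + 2) → ℝ) i).det| =
      vand u * vand v := by
  have h := congrArg abs (det_homEval_mul_det_projVandermonde
    (Fin.cons (∏ k : Fin (m + 1), (X - C (v k)))
      fun i : Fin (m + 1) => ∏ k : Fin m, (X - C (v (i.succAbove k))))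
      u 1 (Fin.cons 1 v) (Fin.cons 0 1))
  have hdeg0 : (∏ k : Fin (m + 1), (X - C (v k))).natDegree < m + 2 := by
    rw [natDegree_prod_X_sub_C_fin]; omega
  have hdeg : ∀ i : Fin (m + 1),
      (∏ k : Fin m, (X - C (v (i.succAbove k)))).natDegree < m + 1 :=
    fun j => by rw [natDegree_prod_X_sub_C_fin]; omega
  have e1 : (Matrix.of fun i j => homEval (m + 2) ((Fin.cons (∏ k : Fin (m + 1), (X - C (v k)))
      fun i : Fin (m + 1) => ∏ k : Fin m, (X - C (v (i.succAbove k))) :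
      Fin (m + 2) → Polynomial ℝ) j) ((Fin.cons 1 v : Fin (m + 2) → ℝ) i)
      ((Fin.cons 0 1 : Fin (m + 2) → ℝ) i)) =
      Matrix.diagonal (Fin.cons 1 (nodeDeriv v)) := by
    ext i j
    refine Fin.cases ?_ (fun i => ?_) i <;> refine Fin.cases ?_ (fun j => ?_) j
    · simp only [Matrix.of_apply, Fin.cons_zero]
      rw [homEval_one_zero, coeff_prod_X_sub_C_fin]
      simp
    · simp only [Matrix.of_apply, Fin.cons_zero, Fin.cons_succ]
      rw [homEval_one_zero, coeff_eq_zero_of_natDegree_lt (hdeg j),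
        Matrix.diagonal_apply_ne _ (Fin.succ_ne_zero j).symm]
    · simp only [Matrix.of_apply, Fin.cons_zero, Fin.cons_succ, Pi.one_apply]
      rw [homEval_one hdeg0, eval_prod, Matrix.diagonal_apply_ne _ (Fin.succ_ne_zero i)]
      exact Finset.prod_eq_zero (Finset.mem_univ i) (by simp)
    · simp only [Matrix.of_apply, Fin.cons_succ, Pi.one_apply]
      rw [homEval_one ((hdeg j).trans (by omega)), eval_prod]
      simp only [eval_sub, eval_X, eval_C]
      rcases eq_or_ne i j with rfl | hij
      · simp [nodeDeriv]
      · obtain ⟨k, rfl⟩ := Fin.exists_succAbove_eq hij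
        rw [Matrix.diagonal_apply_ne _ (by simp)]
        exact Finset.prod_eq_zero (Finset.mem_univ k) (sub_self _)
  have e2 : (Matrix.of fun i j => homEval (m + 2) ((Fin.cons (∏ k : Fin (m + 1), (X - C (v k)))
      fun i : Fin (m + 1) => ∏ k : Fin m, (X - C (v (i.succAbove k))) :
      Fin (m + 2) → Polynomial ℝ) j) (u i) ((1 : Fin (m + 2) → ℝ) i)) =
      Matrix.of fun j i => (Fin.cons (∏ k, (u j - v k))
      fun i : Fin (m + 1) => ∏ k, (u j - v (i.succAbove k)) : Fin (m + 2) → ℝ) i := by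
    ext i j
    refine Fin.cases ?_ (fun j => ?_) j
    · simp only [Matrix.of_apply, Fin.cons_zero, Pi.one_apply]
      rw [homEval_one hdeg0, eval_prod]
      simp
    · simp only [Matrix.of_apply, Fin.cons_succ, Pi.one_apply]
      rw [homEval_one ((hdeg j).trans (by omega)), eval_prod]
      simp
  rw [e1, e2, abs_mul, abs_mul, abs_det_projVandermonde_one hu, abs_det_projVandermonde_infty hv,
    Matrix.det_diagonal, Fin.prod_univ_succ, Fin.cons_zero, one_mul, Finset.abs_prod] at h
  simp only [Fin.cons_succ] at h
  rw [prod_abs_nodeDeriv hv] at h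
  have := vand_pos hv
  apply mul_right_cancel₀ this.ne'
  linarith

theorem strictAnti_of_interlace {n : ℕ} {u : Fin (n + 2) → ℝ} {v : Fin (n + 1) → ℝ}
    (h : Interlace n u v) : StrictAnti u ∧ StrictAnti v := by
  refine ⟨Fin.strictAnti_iff_succ_lt.2 fun i => (h i).2.trans (h i).1,
    Fin.strictAnti_iff_succ_lt.2 fun i => ?_⟩
  have h1 := (h i.castSucc).2
  have h2 := (h i.succ).1
  rw [Fin.succ_castSucc] at h1
  exact h2.trans h1

theorem Interlace.lt_of_le {n : ℕ} {u : Fin (n + 2) → ℝ} {v : Fin (n + 1) → ℝ}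
    (h : Interlace n u v) {i : Fin (n + 1)} {j : Fin (n + 2)} (hj : (j : ℕ) ≤ i) : v i < u j :=
  (h i).1.trans_le ((strictAnti_of_interlace h).1.antitone (by simpa [Fin.le_def] using hj))

theorem Interlace.lt_of_lt {n : ℕ} {u : Fin (n + 2) → ℝ} {v : Fin (n + 1) → ℝ}
    (h : Interlace n u v) {i : Fin (n + 1)} {j : Fin (n + 2)} (hj : (i : ℕ) < j) : u j < v i :=
  ((strictAnti_of_interlace h).1.antitone (by rw [Fin.le_def, Fin.val_succ]; omega)).trans_lt (h i).2

theorem measurableSet_interlace (n : ℕ) :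
    MeasurableSet {p : (Fin (n + 2) → ℝ) × (Fin (n + 1) → ℝ) | Interlace n p.1 p.2} := by
  simp only [Interlace, Set.ofPred_forall, Set.ofPred_and]
  refine MeasurableSet.iInter fun i => MeasurableSet.inter ?_ ?_
  · exact measurableSet_lt (by fun_prop) (by fun_prop)
  · exact measurableSet_lt (by fun_prop) (by fun_prop)

/-- The residues at the points `u j` of `t ∏ (X - v i) / ∏ (X - u j)`, where `t` is the first
coordinate of `x` and `v` the tuple of the remaining ones. -/
noncomputable def residueMap {n : ℕ} (u : Fin (n + 2) → ℝ) (x : Fin (n + 2) → ℝ) :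
    Fin (n + 2) → ℝ :=
  fun j => x 0 * (∏ i : Fin (n + 1), (u j - x i.succ)) * (nodeDeriv u j)⁻¹

/-- The coefficients `a` and `w i` in the expansion
`∏ (X - u j) / ∏ (X - v i) = X - a - ∑ w i / (X - v i)`. -/
noncomputable def rootMap {n : ℕ} (v : Fin (n + 1) → ℝ) (u : Fin (n + 2) → ℝ) :
    Fin (n + 2) → ℝ :=
  Fin.cons (∑ j, u j - ∑ i, v i) fun i => -(∏ j, (v i - u j)) * (nodeDeriv v i)⁻¹

theorem hasFDerivAt_prod_const_sub {ι : Type*} [Fintype ι] {m : ℕ} (c : ℝ) (e : Fin (m + 1) → ι)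
    (x : ι → ℝ) :
    HasFDerivAt (fun x : ι → ℝ => ∏ i, (c - x (e i)))
      (∑ i, (∏ k : Fin m, (c - x (e (i.succAbove k)))) •
        -ContinuousLinearMap.proj (R := ℝ) (φ := fun _ : ι => ℝ) (e i)) x := by
  classical
  have h := HasFDerivAt.finsetProd (u := Finset.univ) (g := fun i (x : ι → ℝ) => c - x (e i))
    (g' := fun i => -ContinuousLinearMap.proj (R := ℝ) (φ := fun _ : ι => ℝ) (e i)) (x := x)
    fun i _ => (hasFDerivAt_apply (e i) x).const_sub c
  simp_rw [prod_erase_eq_prod_succAbove] at h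
  exact h

/-- The Jacobian matrix of `residueMap u`. -/
noncomputable def residueJacobian {n : ℕ} (u x : Fin (n + 2) → ℝ) :
    Matrix (Fin (n + 2)) (Fin (n + 2)) ℝ :=
  Matrix.of fun j i => (nodeDeriv u j)⁻¹ * ((Fin.cons 1 fun _ => -x 0 : Fin (n + 2) → ℝ) i *
    (Fin.cons (∏ k : Fin (n + 1), (u j - x k.succ))
      fun i : Fin (n + 1) => ∏ k : Fin n, (u j - x (i.succAbove k).succ) : Fin (n + 2) → ℝ) i)

theorem hasFDerivAt_residueMap {n : ℕ} (u x : Fin (n + 2) → ℝ) :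
    HasFDerivAt (residueMap u)
      (LinearMap.toContinuousLinearMap (Matrix.toLin' (residueJacobian u x))) x := by
  rw [hasFDerivAt_pi']
  intro j
  refine (((hasFDerivAt_apply (0 : Fin (n + 2)) x).mul
    (hasFDerivAt_prod_const_sub (u j) Fin.succ x)).mul_const (nodeDeriv u j)⁻¹).congr_fderiv ?_
  ext y
  have hy : ((ContinuousLinearMap.proj (R := ℝ) (φ := fun _ : Fin (n + 2) => ℝ) j).comp
      (LinearMap.toContinuousLinearMap (Matrix.toLin' (residueJacobian u x)))) y =
      residueJacobian u x j 0 * y 0 + ∑ i : Fin (n + 1), residueJacobian u x j i.succ * y i.succ :=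
    Fin.sum_univ_succ fun i => residueJacobian u x j i * y i
  rw [hy]
  simp only [residueJacobian, Matrix.of_apply, Fin.cons_zero, Fin.cons_succ]
  simp [Finset.mul_sum]
  rw [add_comm]
  congr 1
  · ring
  · exact neg_inj.2 (Finset.sum_congr rfl fun i _ => by ring)

theorem abs_det_residueJacobian {n : ℕ} {u x : Fin (n + 2) → ℝ} (hx : 0 < x 0)
    (h : Interlace n u (fun i => x i.succ)) :
    |(residueJacobian u x).det| = x 0 ^ (n + 1) * vand (fun i : Fin (n + 1) => x i.succ) /
      vand u := by
  obtain ⟨hu, hv⟩ := strictAnti_of_interlace h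
  have := abs_det_infty_cols hv hu
  have hpos := vand_pos hu
  have hdet := Matrix.det_mul_column (fun j => (nodeDeriv u j)⁻¹) (Matrix.of fun j i =>
    (Fin.cons 1 fun _ => -x 0 : Fin (n + 2) → ℝ) i * (Matrix.of fun j i =>
      (Fin.cons (∏ k : Fin (n + 1), (u j - x k.succ))
        fun i : Fin (n + 1) => ∏ k, (u j - x (i.succAbove k).succ) : Fin (n + 2) → ℝ) i) j i)
  rw [Matrix.det_mul_row] at hdet
  rw [show (residueJacobian u x).det = _ from hdet, abs_mul, abs_mul, this,
    Finset.prod_inv_distrib, abs_inv, Finset.abs_prod, prod_abs_nodeDeriv hu, Fin.prod_univ_succ]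
  simp [abs_of_pos hx]
  field_simp

/-- The Jacobian matrix of `rootMap v`. -/
noncomputable def rootJacobian {n : ℕ} (v : Fin (n + 1) → ℝ) (u : Fin (n + 2) → ℝ) :
    Matrix (Fin (n + 2)) (Fin (n + 2)) ℝ :=
  Matrix.of fun i j => (Fin.cons 1 fun i => (nodeDeriv v i)⁻¹ : Fin (n + 2) → ℝ) i *
    (Fin.cons 1 fun i : Fin (n + 1) => ∏ k, (v i - u (j.succAbove k)) : Fin (n + 2) → ℝ) i

theorem hasFDerivAt_rootMap {n : ℕ} (v : Fin (n + 1) → ℝ) (u : Fin (n + 2) → ℝ) :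
    HasFDerivAt (rootMap v)
      (LinearMap.toContinuousLinearMap (Matrix.toLin' (rootJacobian v u))) u := by
  rw [hasFDerivAt_pi']
  intro i
  refine Fin.cases ?_ (fun i => ?_) i
  · refine ((HasFDerivAt.fun_sum (u := Finset.univ) fun j _ =>
      hasFDerivAt_apply (j : Fin (n + 2)) u).sub_const (∑ i, v i)).congr_fderiv ?_
    ext y
    simp [Matrix.toLin'_apply, Matrix.mulVec, dotProduct, rootJacobian]
  · refine ((hasFDerivAt_prod_const_sub (v i) id u).neg.mul_const
      (nodeDeriv v i)⁻¹).congr_fderiv ?_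
    ext y
    simp [Matrix.toLin'_apply, Matrix.mulVec, dotProduct, rootJacobian,
      Finset.mul_sum]
    refine Finset.sum_congr rfl fun i _ => by ring

theorem abs_det_rootJacobian {n : ℕ} {u : Fin (n + 2) → ℝ} {v : Fin (n + 1) → ℝ}
    (h : Interlace n u v) : |(rootJacobian v u).det| = vand u / vand v := by
  obtain ⟨hu, hv⟩ := strictAnti_of_interlace h
  have := abs_det_infty_rows hv hu
  have hpos := vand_pos hv
  have hdet := Matrix.det_mul_column (Fin.cons 1 fun i => (nodeDeriv v i)⁻¹)
    (Matrix.of fun i j : Fin (n + 2) => (Fin.cons 1 fun i : Fin (n + 1) =>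
      ∏ k, (v i - u (j.succAbove k)) : Fin (n + 2) → ℝ) i)
  rw [show (rootJacobian v u).det = _ from hdet, abs_mul, this, Fin.prod_univ_succ]
  simp only [Fin.cons_zero, Fin.cons_succ, one_mul]
  rw [Finset.prod_inv_distrib, abs_inv, Finset.abs_prod, prod_abs_nodeDeriv hv]
  field_simp

theorem degree_lt_coe_of_natDegree_lt {p : Polynomial ℝ} {m : ℕ} (h : p.natDegree < m) :
    p.degree < (m : WithBot ℕ) :=
  Polynomial.degree_le_natDegree.trans_lt (by exact_mod_cast h)

theorem sum_mul_prod_succAbove_self {m : ℕ} (u w : Fin (m + 1) → ℝ) (l : Fin (m + 1)) :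
    ∑ j, w j * ∏ k : Fin m, (u l - u (j.succAbove k)) = w l * nodeDeriv u l := by
  rw [Finset.sum_eq_single l]
  · rfl
  · intro j _ hj
    obtain ⟨k, rfl⟩ := Fin.exists_succAbove_eq hj.symm
    rw [Finset.prod_eq_zero (Finset.mem_univ k) (sub_self _), mul_zero]
  · simp

open Polynomial in
theorem natDegree_sum_prod_succAbove_le {m : ℕ} (u w : Fin (m + 1) → ℝ) :
    (∑ j, C (w j) * ∏ k : Fin m, (X - C (u (j.succAbove k)))).natDegree ≤ m := by
  refine natDegree_sum_le_of_forall_le _ _ fun j _ => ?_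
  refine (natDegree_C_mul_le _ _).trans ?_
  rw [natDegree_prod_X_sub_C_fin]

open Polynomial in
theorem coeff_sum_prod_succAbove {m : ℕ} (u w : Fin (m + 1) → ℝ) :
    (∑ j, C (w j) * ∏ k : Fin m, (X - C (u (j.succAbove k)))).coeff m = ∑ j, w j := by
  rw [finsetSum_coeff]
  exact Finset.sum_congr rfl fun j _ => by rw [coeff_C_mul, coeff_prod_X_sub_C_fin, mul_one]

open Polynomial in
theorem residueMap_polynomial {n : ℕ} {u : Fin (n + 2) → ℝ} (hu : Function.Injective u)
    (x : Fin (n + 2) → ℝ) :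
    C (x 0) * ∏ i : Fin (n + 1), (X - C (x i.succ)) =
      ∑ j, C (residueMap u x j) * ∏ k : Fin (n + 1), (X - C (u (j.succAbove k))) := by
  refine eq_of_degrees_lt_of_eval_index_eq Finset.univ (v := u) hu.injOn ?_ ?_ fun l _ => ?_
  · rw [Finset.card_univ, Fintype.card_fin]
    refine degree_lt_coe_of_natDegree_lt ((natDegree_C_mul_le _ _).trans_lt ?_)
    rw [natDegree_prod_X_sub_C_fin]
    omega
  · rw [Finset.card_univ, Fintype.card_fin]
    exact degree_lt_coe_of_natDegree_lt 
      ((natDegree_sum_prod_succAbove_le u (residueMap u x)).trans_lt (by omega))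
  · simp only [eval_mul, eval_C, eval_prod, eval_sub, eval_X, eval_finsetSum]
    rw [sum_mul_prod_succAbove_self, residueMap, inv_mul_cancel_right₀ (nodeDeriv_ne_zero hu l)]

theorem sum_residueMap {n : ℕ} {u : Fin (n + 2) → ℝ} (hu : Function.Injective u)
    (x : Fin (n + 2) → ℝ) : ∑ j, residueMap u x j = x 0 := by
  have h := congrArg (fun p => Polynomial.coeff p (n + 1)) (residueMap_polynomial hu x)
  simp only [coeff_sum_prod_succAbove, Polynomial.coeff_C_mul, coeff_prod_X_sub_C_fin] at h
  linarith

theorem residueMap_eval {n : ℕ} {u : Fin (n + 2) → ℝ} (hu : Function.Injective u)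
    (x : Fin (n + 2) → ℝ) (y : ℝ) :
    x 0 * ∏ i : Fin (n + 1), (y - x i.succ) =
      ∑ j, residueMap u x j * ∏ k : Fin (n + 1), (y - u (j.succAbove k)) := by
  have h := congrArg (Polynomial.eval y) (residueMap_polynomial hu x)
  simpa [Polynomial.eval_prod, Polynomial.eval_finsetSum] using h

theorem injOn_residueMap {n : ℕ} (u : Fin (n + 2) → ℝ) :
    Set.InjOn (residueMap u) {x | 0 < x 0 ∧ Interlace n u fun i => x i.succ} := by
  rintro x ⟨hx0, hx⟩ y ⟨hy0, hy⟩ hxy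
  have hu := (strictAnti_of_interlace hx).1.injective
  have h0 : x 0 = y 0 := by rw [← sum_residueMap hu x, ← sum_residueMap hu y, hxy]
  ext j
  refine Fin.cases h0 (fun i => ?_) j
  have h := residueMap_eval hu x (x i.succ)
  rw [hxy, ← residueMap_eval hu y, Finset.prod_eq_zero (Finset.mem_univ i) (sub_self _), mul_zero,
    eq_comm, mul_eq_zero, or_iff_right hy0.ne', Finset.prod_eq_zero_iff] at h
  obtain ⟨k, -, hk⟩ := h
  have hk := sub_eq_zero.1 hk
  rcases lt_trichotomy (i : ℕ) k with h | h | h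
  · have h1 := hy.lt_of_le (i := k) (j := i.succ) (by simpa using h)
    have h2 := (hx i).2
    linarith
  · obtain rfl := Fin.ext h
    exact hk
  · have h1 := hx.lt_of_le (i := i) (j := k.succ) (by simpa using h)
    have h2 := (hy k).2
    linarith

theorem image_residueMap {n : ℕ} {u : Fin (n + 2) → ℝ} (hu : StrictAnti u) :
    residueMap u '' {x | 0 < x 0 ∧ Interlace n u fun i => x i.succ} = {w | ∀ j, 0 < w j} := by
  ext w
  constructor
  · rintro ⟨x, ⟨hx0, hx⟩, rfl⟩ j
    have h1 := nodeDeriv_sign hu j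
    have h2 := neg_one_pow_mul_prod_pos (fun i : Fin (n + 1) => x i.succ) (u j) j (by omega)
      (fun i hi => hx.lt_of_lt hi) (fun i hi => hx.lt_of_le hi)
    have h3 := mul_pos hx0 (div_pos h2 h1)
    rw [mul_div_mul_left _ _ (pow_ne_zero _ (by norm_num))] at h3
    rw [residueMap, mul_assoc]
    exact h3
  · intro hw
    obtain ⟨r, hr⟩ := exists_interlacing_roots hu
      (q := fun y => ∑ j, w j * ∏ k : Fin (n + 1), (y - u (j.succAbove k))) (by fun_prop)
      (fun k => by
        have := mul_pos (hw k) (nodeDeriv_sign hu k)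
        simp only [sum_mul_prod_succAbove_self]
        linarith)
    have hr' : Interlace n u r := fun i => ⟨(hr i).2.1, (hr i).1⟩
    refine ⟨Fin.cons (∑ j, w j) r, ⟨?_, by simpa using hr'⟩, ?_⟩
    · simpa using Finset.sum_pos (fun j _ => hw j) Finset.univ_nonempty
    · have hpoly : Polynomial.C (∑ j, w j) * ∏ i, (Polynomial.X - Polynomial.C (r i)) =
          ∑ j, Polynomial.C (w j) *
            ∏ k : Fin (n + 1), (Polynomial.X - Polynomial.C (u (j.succAbove k))) := by
        refine Polynomial.eq_of_degree_sub_lt_of_eval_index_eq Finset.univ (v := r)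
          (strictAnti_of_interlace hr').2.injective.injOn ?_ fun l _ => ?_
        · rw [Finset.card_univ, Fintype.card_fin, Polynomial.degree_lt_iff_coeff_zero]
          intro m hm
          rcases hm.eq_or_lt with rfl | hm
          · rw [Polynomial.coeff_sub, coeff_sum_prod_succAbove, Polynomial.coeff_C_mul,
              coeff_prod_X_sub_C_fin]
            ring
          · rw [Polynomial.coeff_sub, Polynomial.coeff_eq_zero_of_natDegree_lt,
              Polynomial.coeff_eq_zero_of_natDegree_lt, sub_zero]
            · exact (natDegree_sum_prod_succAbove_le u w).trans_lt hm
            · refine (Polynomial.natDegree_C_mul_le _ _).trans_lt ?_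
              rwa [natDegree_prod_X_sub_C_fin]
        · have := (hr l).2.2
          simp only [Polynomial.eval_mul, Polynomial.eval_C, Polynomial.eval_prod,
            Polynomial.eval_sub, Polynomial.eval_X, Polynomial.eval_finsetSum]
          rw [this, Finset.prod_eq_zero (Finset.mem_univ l) (sub_self _), mul_zero]
      ext l
      have h := congrArg (Polynomial.eval (u l)) hpoly
      simp only [Polynomial.eval_mul, Polynomial.eval_C, Polynomial.eval_prod,
            Polynomial.eval_sub, Polynomial.eval_X, Polynomial.eval_finsetSum] at h
      rw [sum_mul_prod_succAbove_self] at h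
      simp only [residueMap, Fin.cons_zero, Fin.cons_succ]
      rw [h, mul_inv_cancel_right₀ (nodeDeriv_ne_zero hu.injective l)]

open Polynomial in
theorem rootMap_polynomial {n : ℕ} {v : Fin (n + 1) → ℝ} (hv : Function.Injective v)
    (u : Fin (n + 2) → ℝ) :
    ∏ j, (X - C (u j)) = (X - C (rootMap v u 0)) * ∏ i, (X - C (v i)) -
      ∑ i : Fin (n + 1), C (rootMap v u i.succ) * ∏ k : Fin n, (X - C (v (i.succAbove k))) := by
  have hm : ((X - C (rootMap v u 0)) * ∏ i, (X - C (v i))).Monic :=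
    (monic_X_sub_C _).mul (monic_prod_of_monic _ _ fun i _ => monic_X_sub_C (v i))
  have hd : ((X - C (rootMap v u 0)) * ∏ i, (X - C (v i))).natDegree = n + 2 := by
    rw [(monic_X_sub_C _).natDegree_mul (monic_prod_of_monic _ _ fun i _ => monic_X_sub_C (v i)),
      natDegree_X_sub_C, natDegree_prod_X_sub_C_fin]
    omega
  refine eq_of_degree_sub_lt_of_eval_index_eq Finset.univ (v := v) hv.injOn ?_ fun l _ => ?_
  · rw [Finset.card_univ, Fintype.card_fin, degree_lt_iff_coeff_zero]
    intro m hm'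
    rw [coeff_sub, coeff_sub, coeff_eq_zero_of_natDegree_lt
      ((natDegree_sum_prod_succAbove_le v fun i => rootMap v u i.succ).trans_lt hm')]
    obtain rfl | rfl | hm' : m = n + 1 ∨ m = n + 2 ∨ n + 2 < m := by omega
    · have h1 := prod_X_sub_C_coeff_card_pred Finset.univ u (by simp)
      have h2 := prod_X_sub_C_coeff_card_pred Finset.univ v (by simp)
      simp only [Finset.card_univ, Fintype.card_fin] at h1 h2
      rw [show n + 2 - 1 = n + 1 by omega] at h1
      rw [show n + 1 - 1 = n by omega] at h2
      rw [h1, sub_mul, coeff_sub, coeff_X_mul, h2, coeff_C_mul, coeff_prod_X_sub_C_fin]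
      simp only [rootMap, Fin.cons_zero]
      ring
    · have := hm.coeff_natDegree
      rw [hd] at this
      rw [this, coeff_prod_X_sub_C_fin]
      ring
    · rw [coeff_eq_zero_of_natDegree_lt, coeff_eq_zero_of_natDegree_lt]
      · ring
      · rwa [hd]
      · rwa [natDegree_prod_X_sub_C_fin]
  · simp only [eval_mul, eval_C, eval_prod, eval_sub, eval_X, eval_finsetSum]
    rw [sum_mul_prod_succAbove_self v fun i => rootMap v u i.succ,
      Finset.prod_eq_zero (f := fun i => v l - v i) (Finset.mem_univ l) (sub_self _)]
    simp only [rootMap, Fin.cons_succ]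
    rw [inv_mul_cancel_right₀ (nodeDeriv_ne_zero hv l)]
    ring

theorem rootMap_eval {n : ℕ} {v : Fin (n + 1) → ℝ} (hv : Function.Injective v)
    (u : Fin (n + 2) → ℝ) (y : ℝ) :
    ∏ j, (y - u j) = (y - rootMap v u 0) * ∏ i, (y - v i) -
      ∑ i : Fin (n + 1), rootMap v u i.succ * ∏ k : Fin n, (y - v (i.succAbove k)) := by
  have h := congrArg (Polynomial.eval y) (rootMap_polynomial hv u)
  simpa [Polynomial.eval_prod, Polynomial.eval_finsetSum] using h

theorem injOn_rootMap {n : ℕ} (v : Fin (n + 1) → ℝ) :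
    Set.InjOn (rootMap v) {u | Interlace n u v} := by
  intro x hx y hy hxy
  have hv := (strictAnti_of_interlace hx).2.injective
  ext i
  have h := rootMap_eval hv x (x i)
  rw [hxy, ← rootMap_eval hv y, Finset.prod_eq_zero (Finset.mem_univ i) (sub_self _),
    eq_comm, Finset.prod_eq_zero_iff] at h
  obtain ⟨k, -, hk⟩ := h
  have hk := sub_eq_zero.1 hk
  rcases lt_trichotomy (i : ℕ) k with h | h | h
  · have h1 := Interlace.lt_of_le hx (i := ⟨i, by omega⟩) (j := i) le_rfl
    have h2 := Interlace.lt_of_lt hy (i := ⟨i, by omega⟩) (j := k) h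
    linarith
  · obtain rfl := Fin.ext h
    exact hk
  · have h1 := Interlace.lt_of_le hy (i := ⟨k, by omega⟩) (j := k) le_rfl
    have h2 := Interlace.lt_of_lt hx (i := ⟨k, by omega⟩) (j := i) h
    linarith

open Polynomial in
theorem eq_zero_of_prod_eq_sum {n : ℕ} {v : Fin (n + 1) → ℝ} (hv : Function.Injective v)
    {r : Fin (n + 2) → ℝ} (hr : Function.Injective r) (a : ℝ) (w : Fin (n + 1) → ℝ)
    (h : ∀ j, a * ∏ i, (r j - v i) = ∑ i, w i * ∏ k : Fin n, (r j - v (i.succAbove k))) :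
    a = 0 ∧ w = 0 := by
  have hpoly : C a * ∏ i, (X - C (v i)) =
      ∑ i, C (w i) * ∏ k : Fin n, (X - C (v (i.succAbove k))) := by
    refine eq_of_degrees_lt_of_eval_index_eq Finset.univ (v := r) hr.injOn ?_ ?_ fun l _ => ?_
    · rw [Finset.card_univ, Fintype.card_fin]
      refine degree_lt_coe_of_natDegree_lt ((natDegree_C_mul_le _ _).trans_lt ?_)
      rw [natDegree_prod_X_sub_C_fin]
      omega
    · rw [Finset.card_univ, Fintype.card_fin]
      exact degree_lt_coe_of_natDegree_lt 
        ((natDegree_sum_prod_succAbove_le v w).trans_lt (by omega))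
    · simpa [eval_prod, eval_finsetSum] using h l
  constructor
  · have h := congrArg (fun p => Polynomial.coeff p (n + 1)) hpoly
    simp only [coeff_C_mul, coeff_prod_X_sub_C_fin] at h
    rw [coeff_eq_zero_of_natDegree_lt
      ((natDegree_sum_prod_succAbove_le v w).trans_lt (Nat.lt_succ_self n))] at h
    linarith
  · ext l
    have h := congrArg (Polynomial.eval (v l)) hpoly
    simp only [eval_mul, eval_C, eval_prod, eval_sub, eval_X, eval_finsetSum] at h
    rw [sum_mul_prod_succAbove_self, Finset.prod_eq_zero (Finset.mem_univ l) (sub_self _),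
      mul_zero, eq_comm, mul_eq_zero, or_iff_left (nodeDeriv_ne_zero hv l)] at h
    exact h

theorem image_rootMap {n : ℕ} {v : Fin (n + 1) → ℝ} (hv : StrictAnti v) :
    rootMap v '' {u | Interlace n u v} = {y | ∀ i : Fin (n + 1), 0 < y i.succ} := by
  ext y
  constructor
  · rintro ⟨x, hx, rfl⟩ i
    have h1 := nodeDeriv_sign hv i
    have h2 := neg_one_pow_mul_prod_pos x (v i) (i + 1) (by omega)
      (fun j hj => Interlace.lt_of_le hx (by omega)) (fun j hj => Interlace.lt_of_lt hx (by omega))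
    have h3 := div_pos h2 h1
    rw [pow_succ, mul_assoc, mul_div_mul_left _ _ (pow_ne_zero _ (by norm_num)), neg_one_mul] at h3
    simp only [rootMap, Fin.cons_succ]
    rw [← div_eq_mul_inv]
    exact h3
  · intro hy
    set q : ℝ → ℝ := fun x => (x - y 0) * ∏ i, (x - v i) -
      ∑ i : Fin (n + 1), y i.succ * ∏ k : Fin n, (x - v (i.succAbove k)) with hq
    have hqv : ∀ i, q (v i) = -(y i.succ * nodeDeriv v i) := fun i => by
      rw [hq]
      simp only
      rw [sum_mul_prod_succAbove_self v fun i => y i.succ,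
        Finset.prod_eq_zero (Finset.mem_univ i) (sub_self _)]
      ring
    have hqf : ∀ x, (∀ i, x ≠ v i) →
        q x = (∏ i, (x - v i)) * (x - y 0 - ∑ i : Fin (n + 1), y i.succ / (x - v i)) := by
      intro x hx
      rw [hq]
      simp only
      rw [mul_sub, mul_comm, Finset.mul_sum]
      congr 1
      refine Finset.sum_congr rfl fun i _ => ?_
      rw [Fin.prod_univ_succAbove _ i]
      field_simp [sub_ne_zero.2 (hx i)]
    obtain ⟨A, hA1, hA2⟩ : ∃ A, (∀ i, v i + 1 < A) ∧ y 0 + ∑ i : Fin (n + 1), y i.succ < A :=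
      (((Filter.eventually_all.2 fun i => Filter.eventually_gt_atTop (v i + 1)).and
        (Filter.eventually_gt_atTop (y 0 + ∑ i : Fin (n + 1), y i.succ)))).exists
    obtain ⟨B, hB1, hB2⟩ : ∃ B, (∀ i, B < v i - 1) ∧ B < y 0 - ∑ i : Fin (n + 1), y i.succ :=
      (((Filter.eventually_all.2 fun i => Filter.eventually_lt_atBot (v i - 1)).and
        (Filter.eventually_lt_atBot (y 0 - ∑ i : Fin (n + 1), y i.succ)))).exists
    have hqA : 0 < q A := by
      rw [hqf A fun i => by have := hA1 i; intro h; linarith]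
      refine mul_pos (Finset.prod_pos fun i _ => by linarith [hA1 i]) ?_
      have : ∑ i : Fin (n + 1), y i.succ / (A - v i) ≤ ∑ i : Fin (n + 1), y i.succ :=
        Finset.sum_le_sum fun i _ => div_le_self (hy i).le (by linarith [hA1 i])
      linarith
    have hqB : 0 < (-1) ^ (n + 2) * q B := by
      rw [hqf B fun i => by have := hB1 i; intro h; linarith]
      have h1 := neg_one_pow_mul_prod_pos v B (n + 1) le_rfl
        (fun i _ => by linarith [hB1 i]) (fun i hi => by omega)
      have h2 : -∑ i : Fin (n + 1), y i.succ ≤ ∑ i : Fin (n + 1), y i.succ / (B - v i) := by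
        rw [← Finset.sum_neg_distrib]
        refine Finset.sum_le_sum fun i _ => ?_
        have := div_le_self (hy i).le (show 1 ≤ v i - B by linarith [hB1 i])
        rw [← neg_sub (v i) B, div_neg]
        linarith
      have h3 : 0 < -(B - y 0 - ∑ i : Fin (n + 1), y i.succ / (B - v i)) := by linarith
      have := mul_pos h1 h3
      rw [pow_succ]
      linarith
    set z : Fin (n + 3) → ℝ := Fin.cons A (Fin.snoc v B : Fin (n + 2) → ℝ) with hz
    have hz0 : z 0 = A := rfl
    have hzv : ∀ i : Fin (n + 1), z i.castSucc.succ = v i := fun i => by simp [hz]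
    have hzB : z (Fin.last (n + 1)).succ = B := by simp [hz]
    have hza : StrictAnti z := by
      refine Fin.strictAnti_iff_succ_lt.2 fun k => ?_
      refine Fin.cases ?_ (fun i => ?_) k
      · have := hzv 0
        rw [Fin.castSucc_zero] at this
        rw [this, Fin.castSucc_zero, hz0]
        linarith [hA1 0]
      · rw [← Fin.succ_castSucc, hzv]
        refine Fin.lastCases ?_ (fun l => ?_) i
        · rw [Fin.succ_last, hzB]
          linarith [hB1 (Fin.last n)]
        · rw [Fin.succ_castSucc, hzv]
          exact hv Fin.castSucc_lt_succ
    obtain ⟨r, hr⟩ := exists_interlacing_roots hza (q := q) (by fun_prop) (fun k => by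
      refine Fin.cases ?_ (fun i => ?_) k
      · simpa [hz0] using hqA
      · refine Fin.lastCases ?_ (fun l => ?_) i
        · rw [hzB, Fin.val_succ, Fin.val_last]
          exact hqB
        · rw [hzv, hqv, Fin.val_succ, Fin.val_castSucc, pow_succ]
          have := mul_pos (hy l) (nodeDeriv_sign hv l)
          linarith)
    have hrv : Interlace n r v := by
      intro i
      have h1 := (hr i.castSucc).1
      have h2 := (hr i.succ).2.1
      rw [← Fin.succ_castSucc, hzv] at h2
      rw [hzv] at h1
      exact ⟨h1, h2⟩
    refine ⟨r, hrv, ?_⟩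
    have h := eq_zero_of_prod_eq_sum hv.injective (strictAnti_of_interlace hrv).1.injective
      (y 0 - rootMap v r 0) (fun i => rootMap v r i.succ - y i.succ) fun j => by
        have h1 := rootMap_eval hv.injective r (r j)
        have h2 := (hr j).2.2
        rw [Finset.prod_eq_zero (Finset.mem_univ j) (sub_self _)] at h1
        simp only [hq] at h2
        simp only [sub_mul, Finset.sum_sub_distrib] at h1 h2 ⊢
        linarith
    ext j
    refine Fin.cases ?_ (fun i => ?_) j
    · linarith [h.1]
    · have := congrFun h.2 i
      simp only [Pi.zero_apply] at this
      linarith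

open MeasureTheory in
theorem lintegral_fin_succ {n : ℕ} {F : (Fin (n + 1) → ℝ) → ENNReal} (hF : Measurable F) :
    ∫⁻ x, F x = ∫⁻ t : ℝ, ∫⁻ v : Fin n → ℝ, F (Fin.cons t v) := by
  have h := (volume_preserving_piFinSuccAbove (fun _ : Fin (n + 1) => ℝ) 0).symm
  have he : ∀ p : ℝ × (Fin n → ℝ),
      (MeasurableEquiv.piFinSuccAbove (fun _ : Fin (n + 1) => ℝ) 0).symm p = Fin.cons p.1 p.2 := by
    intro p
    ext j
    simp [MeasurableEquiv.piFinSuccAbove, Fin.insertNthEquiv]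
  rw [← h.lintegral_comp hF, Measure.volume_eq_prod, lintegral_prod _ (by fun_prop)]
  simp only [he]

open MeasureTheory in
theorem lintegral_fin_prod {n : ℕ} {f : Fin n → ℝ → ENNReal} (hf : ∀ i, Measurable (f i)) :
    ∫⁻ x : Fin n → ℝ, ∏ i, f i (x i) = ∏ i, ∫⁻ y, f i y := by
  induction n with
  | zero => simp [volume_pi]
  | succ n ih =>
    rw [lintegral_fin_succ (by fun_prop)]
    simp only [Fin.prod_univ_succ, Fin.cons_zero, Fin.cons_succ]
    rw [← ih fun i => hf i.succ, ← lintegral_mul_const _ (hf 0)]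
    refine lintegral_congr fun t => lintegral_const_mul _ (by fun_prop)

theorem residueMap_pos {n : ℕ} {u x : Fin (n + 2) → ℝ} (hx0 : 0 < x 0)
    (hx : Interlace n u fun i => x i.succ) (j : Fin (n + 2)) : 0 < residueMap u x j :=
  (image_residueMap (strictAnti_of_interlace hx).1).subset
    (Set.mem_image_of_mem (residueMap u) (⟨hx0, hx⟩ : 0 < x 0 ∧ _)) j

theorem Interlace.prod_abs_pos {n : ℕ} {u : Fin (n + 2) → ℝ} {v : Fin (n + 1) → ℝ}
    (h : Interlace n u v) : ∀ i j, 0 < |v i - u j| := by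
  intro i j
  rw [abs_pos]
  rcases le_or_gt (j : ℕ) i with hij | hij
  · exact (sub_neg.2 (h.lt_of_le hij)).ne
  · exact (sub_pos.2 (h.lt_of_lt hij)).ne'

theorem prod_residueMap {n : ℕ} {u x : Fin (n + 2) → ℝ} (hx0 : 0 < x 0)
    (hx : Interlace n u fun i => x i.succ) :
    ∏ j, residueMap u x j =
      x 0 ^ (n + 2) * (∏ i : Fin (n + 1), ∏ j, |x i.succ - u j|) / vand u ^ 2 := by
  have h : ∏ j, residueMap u x j = |∏ j, residueMap u x j| :=
    (abs_of_pos (Finset.prod_pos fun j _ => residueMap_pos hx0 hx j)).symm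
  rw [h, Finset.abs_prod, ← prod_abs_nodeDeriv (strictAnti_of_interlace hx).1, Finset.prod_comm]
  simp only [residueMap, abs_mul, abs_inv, Finset.abs_prod, abs_of_pos hx0, Finset.prod_mul_distrib,
    Finset.prod_const, Finset.card_univ, Fintype.card_fin, Finset.prod_inv_distrib,
    abs_sub_comm (x _) (u _), div_eq_mul_inv]

/-- The kernel `Lkern` on interlacing pairs, without its Gamma factors. -/
noncomputable def interlaceWeight (τ : ℝ) {n : ℕ} (u : Fin (n + 2) → ℝ) (v : Fin (n + 1) → ℝ) : ℝ :=
  vand u ^ (1 - 2 * τ) * vand v * ∏ i, ∏ j, |v i - u j| ^ (τ - 1)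

theorem Lkern_of_interlace (τ : ℝ) {n : ℕ} {u : Fin (n + 2) → ℝ} {v : Fin (n + 1) → ℝ}
    (h : Interlace n u v) : Lkern τ n u v =
      Real.Gamma ((n + 2 : ℝ) * τ) / Real.Gamma τ ^ (n + 2) * interlaceWeight τ u v := by
  rw [Lkern, if_pos h, prod_rpow_eq_vand_rpow (strictAnti_of_interlace h).1, interlaceWeight]
  simp only [vand]
  ring

theorem abs_det_mul_prod_residueMap (τ : ℝ) {n : ℕ} {u x : Fin (n + 2) → ℝ} (hx0 : 0 < x 0)
    (hx : Interlace n u fun i => x i.succ) :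
    |(residueJacobian u x).det| *
        ∏ j, (Real.exp (-residueMap u x j) * residueMap u x j ^ (τ - 1)) =
      Real.exp (-x 0) * x 0 ^ ((n + 2 : ℝ) * τ - 1) * interlaceWeight τ u fun i => x i.succ := by
  have hu := (strictAnti_of_interlace hx).1
  have hV := vand_pos hu
  set P := ∏ i : Fin (n + 1), ∏ j, |x i.succ - u j| with hPdef
  have hP : 0 < P := Finset.prod_pos fun i _ => Finset.prod_pos fun j _ => hx.prod_abs_pos i j
  rw [abs_det_residueJacobian hx0 hx, Finset.prod_mul_distrib, ← Real.exp_sum,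
    Finset.sum_neg_distrib, sum_residueMap hu.injective,
    Real.finsetProd_rpow _ _ fun j _ => (residueMap_pos hx0 hx j).le, prod_residueMap hx0 hx,
    interlaceWeight]
  have hPp : ∏ i : Fin (n + 1), ∏ j, |x i.succ - u j| ^ (τ - 1) = P ^ (τ - 1) := by
    rw [hPdef, ← Real.finsetProd_rpow _ _ fun i _ => Finset.prod_nonneg fun j _ => abs_nonneg _]
    exact Finset.prod_congr rfl fun i _ => Real.finsetProd_rpow _ _ (fun j _ => abs_nonneg _) _
  rw [hPp, ← hPdef, Real.div_rpow (by positivity) (by positivity), Real.mul_rpow (by positivity) hP.le,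
    ← Real.rpow_natCast_mul hx0.le, ← Real.rpow_natCast_mul hV.le,
    show ((n + 2 : ℝ) * τ - 1) = (n + 1 : ℕ) + ((n + 2 : ℕ) : ℝ) * (τ - 1) by push_cast; ring,
    Real.rpow_add hx0, Real.rpow_natCast,
    show (1 - 2 * τ) = -1 - ((2 : ℕ) : ℝ) * (τ - 1) by push_cast; ring, Real.rpow_sub hV,
    Real.rpow_neg_one]
  field_simp

open MeasureTheory in
theorem lintegral_Ioi_gamma {τ : ℝ} (hτ : 0 < τ) :
    ∫⁻ x in Set.Ioi (0 : ℝ), ENNReal.ofReal (Real.exp (-x) * x ^ (τ - 1)) =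
      ENNReal.ofReal (Real.Gamma τ) := by
  rw [Real.Gamma_eq_integral hτ, ofReal_integral_eq_lintegral_ofReal
    (Real.GammaIntegral_convergent hτ)]
  filter_upwards [ae_restrict_mem measurableSet_Ioi] with x hx
  exact mul_nonneg (Real.exp_pos _).le (Real.rpow_nonneg (le_of_lt hx) _)

theorem continuous_vand (m : ℕ) : Continuous (vand : (Fin m → ℝ) → ℝ) := by
  refine continuous_finsetProd _ fun i _ => continuous_finsetProd _ fun j _ => ?_
  split_ifs <;> fun_prop

theorem measurable_interlaceWeight (τ : ℝ) (n : ℕ) :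
    Measurable fun p : (Fin (n + 2) → ℝ) × (Fin (n + 1) → ℝ) => interlaceWeight τ p.1 p.2 := by
  have h1 := (continuous_vand (n + 2)).measurable
  have h2 := (continuous_vand (n + 1)).measurable
  unfold interlaceWeight
  fun_prop

theorem measurable_Lkern (τ : ℝ) (n : ℕ) :
    Measurable fun p : (Fin (n + 2) → ℝ) × (Fin (n + 1) → ℝ) => Lkern τ n p.1 p.2 := by
  refine Measurable.ite (measurableSet_interlace n) ?_ measurable_const
  refine Measurable.mul (Measurable.mul (Measurable.mul measurable_const ?_) ?_) (by fun_prop)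
  all_goals
    refine Finset.measurable_prod _ fun i _ => Finset.measurable_prod _ fun j _ => ?_
    split_ifs <;> fun_prop

theorem interlaceWeight_pos (τ : ℝ) {n : ℕ} {u : Fin (n + 2) → ℝ} {v : Fin (n + 1) → ℝ}
    (h : Interlace n u v) : 0 < interlaceWeight τ u v :=
  mul_pos (mul_pos (Real.rpow_pos_of_pos (vand_pos (strictAnti_of_interlace h).1) _)
    (vand_pos (strictAnti_of_interlace h).2)) <| Finset.prod_pos fun i _ =>
      Finset.prod_pos fun j _ => Real.rpow_pos_of_pos (h.prod_abs_pos i j) _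

theorem Lkern_nonneg {τ : ℝ} (hτ : 0 < τ) {n : ℕ} (u : Fin (n + 2) → ℝ) (v : Fin (n + 1) → ℝ) :
    0 ≤ Lkern τ n u v := by
  by_cases h : Interlace n u v
  · rw [Lkern_of_interlace τ h]
    exact mul_nonneg (div_nonneg (Real.Gamma_nonneg_of_nonneg (by positivity))
      (pow_nonneg (Real.Gamma_pos_of_pos hτ).le _)) (interlaceWeight_pos τ h).le
  · rw [Lkern, if_neg h]

open MeasureTheory in
theorem lintegral_interlaceWeight {τ : ℝ} (hτ : 0 < τ) {n : ℕ} {u : Fin (n + 2) → ℝ}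
    (hu : StrictAnti u) :
    ENNReal.ofReal (Real.Gamma ((n + 2 : ℝ) * τ)) *
        ∫⁻ v in {v | Interlace n u v}, ENNReal.ofReal (interlaceWeight τ u v) =
      ENNReal.ofReal (Real.Gamma τ) ^ (n + 2) := by
  have hI : MeasurableSet {v | Interlace n u v} := measurable_prodMk_left (measurableSet_interlace n)
  have hW : Measurable fun v => ENNReal.ofReal (interlaceWeight τ u v) :=
    ((measurable_interlaceWeight τ n).comp measurable_prodMk_left).ennreal_ofReal
  set S : Set (Fin (n + 2) → ℝ) := {x | 0 < x 0 ∧ Interlace n u fun i => x i.succ} with hS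
  have hSm : MeasurableSet S :=
    (measurableSet_lt measurable_const (measurable_pi_apply 0)).inter
      (hI.preimage (f := fun (x : Fin (n + 2) → ℝ) (i : Fin (n + 1)) => x i.succ) (by fun_prop))
  set φ : ℝ → ENNReal := fun x => ENNReal.ofReal (Real.exp (-x) * x ^ (τ - 1)) with hφ
  have hφm : Measurable φ := by fun_prop
  have hcov := lintegral_image_eq_lintegral_abs_det_fderiv_mul volume hSm
    (fun x _ => (hasFDerivAt_residueMap u x).hasFDerivWithinAt) (injOn_residueMap u)
    fun w => ∏ j, φ (w j)
  rw [image_residueMap hu] at hcov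
  have hpm : MeasurableSet {w : Fin (n + 2) → ℝ | ∀ j, 0 < w j} := by
    simp only [Set.ofPred_forall]
    exact MeasurableSet.iInter fun j => measurableSet_lt measurable_const (measurable_pi_apply j)
  have hL : ∫⁻ w in {w : Fin (n + 2) → ℝ | ∀ j, 0 < w j}, ∏ j, φ (w j) =
      ENNReal.ofReal (Real.Gamma τ) ^ (n + 2) := by
    rw [← lintegral_indicator hpm]
    have : ∀ w : Fin (n + 2) → ℝ, Set.indicator {w | ∀ j, 0 < w j} (fun w => ∏ j, φ (w j)) w =
        ∏ j, (Set.Ioi 0).indicator φ (w j) := by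
      intro w
      by_cases hw : ∀ j, 0 < w j
      · rw [Set.indicator_of_mem (by exact hw)]
        exact Finset.prod_congr rfl fun j _ => (Set.indicator_of_mem (by exact hw j) _).symm
      · rw [Set.indicator_of_notMem (by exact hw)]
        obtain ⟨j, hj⟩ := not_forall.1 hw
        have h0 : (Set.Ioi 0).indicator φ (w j) = 0 := Set.indicator_of_notMem (by exact hj) _
        exact (Finset.prod_eq_zero (Finset.mem_univ j) h0).symm
    rw [lintegral_congr this, lintegral_fin_prod (f := fun _ => (Set.Ioi 0).indicator φ)
      fun _ => hφm.indicator measurableSet_Ioi]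
    rw [lintegral_indicator measurableSet_Ioi, lintegral_Ioi_gamma hτ]
    simp
  rw [hL] at hcov
  rw [hcov, ← lintegral_indicator hSm, ← lintegral_indicator hI,
    ← lintegral_Ioi_gamma (by positivity : 0 < (n + 2 : ℝ) * τ),
    ← lintegral_indicator measurableSet_Ioi]
  set A := (Set.Ioi 0).indicator
    fun x : ℝ => ENNReal.ofReal (Real.exp (-x) * x ^ ((n + 2 : ℝ) * τ - 1)) with hA
  set B := {v | Interlace n u v}.indicator fun v => ENNReal.ofReal (interlaceWeight τ u v) with hB
  have hAm : Measurable A := Measurable.indicator (by fun_prop) measurableSet_Ioi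
  have hBm : Measurable B := hW.indicator hI
  rw [← lintegral_mul_const _ hAm]
  have hAB := lintegral_fin_succ (n := n + 1)
    (F := fun x => A (x 0) * B fun i : Fin (n + 1) => x i.succ) (by fun_prop)
  simp only [Fin.cons_zero, Fin.cons_succ] at hAB
  rw [← lintegral_congr fun t => lintegral_const_mul (A t) hBm, ← hAB]
  refine lintegral_congr fun x => ?_
  by_cases hx : x ∈ S
  · rw [Set.indicator_of_mem hx, hA, hB, Set.indicator_of_mem (by exact hx.1),
      Set.indicator_of_mem (by exact hx.2), ← ENNReal.ofReal_mul (by have := hx.1; positivity),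
      ← abs_det_mul_prod_residueMap τ hx.1 hx.2, ENNReal.ofReal_mul (abs_nonneg _),
      ENNReal.ofReal_prod_of_nonneg fun j _ => by
        have := residueMap_pos hx.1 hx.2 j
        positivity]
    rw [LinearMap.det_toContinuousLinearMap, LinearMap.det_toLin']
  · rw [Set.indicator_of_notMem hx]
    by_cases h0 : 0 < x 0
    · rw [hB, Set.indicator_of_notMem (s := {v | Interlace n u v}) fun h => hx ⟨h0, h⟩, mul_zero]
    · rw [hA, Set.indicator_of_notMem (s := Set.Ioi 0) (by exact h0), zero_mul]

open MeasureTheory in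
theorem lintegral_Lkern {τ : ℝ} (hτ : 0 < τ) {n : ℕ} {u : Fin (n + 2) → ℝ} (hu : StrictAnti u) :
    ∫⁻ v, ENNReal.ofReal (Lkern τ n u v) = 1 := by
  have hI : MeasurableSet {v | Interlace n u v} := measurable_prodMk_left (measurableSet_interlace n)
  have hW : Measurable fun v => ENNReal.ofReal (interlaceWeight τ u v) :=
    ((measurable_interlaceWeight τ n).comp measurable_prodMk_left).ennreal_ofReal
  have hG := Real.Gamma_pos_of_pos hτ
  have hG' : 0 < Real.Gamma ((n + 2 : ℝ) * τ) := Real.Gamma_pos_of_pos (by positivity)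
  have h : ∀ v, ENNReal.ofReal (Lkern τ n u v) =
      ENNReal.ofReal (Real.Gamma ((n + 2 : ℝ) * τ) / Real.Gamma τ ^ (n + 2)) *
        {v | Interlace n u v}.indicator (fun v => ENNReal.ofReal (interlaceWeight τ u v)) v := by
    intro v
    by_cases hv : Interlace n u v
    · rw [Set.indicator_of_mem (by exact hv), Lkern_of_interlace τ hv,
        ENNReal.ofReal_mul (by positivity)]
    · rw [Set.indicator_of_notMem (by exact hv), Lkern, if_neg hv, ENNReal.ofReal_zero, mul_zero]
  rw [lintegral_congr h, lintegral_const_mul _ (hW.indicator hI), lintegral_indicator hI,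
    ENNReal.ofReal_div_of_pos (by positivity), ENNReal.div_eq_inv_mul, mul_assoc,
    lintegral_interlaceWeight hτ hu, ENNReal.ofReal_pow hG.le]
  exact ENNReal.inv_mul_cancel (by simpa using hG) (by simp)

open MeasureTheory in
theorem integral_Lkern {τ : ℝ} (hτ : 0 < τ) {n : ℕ} {u : Fin (n + 2) → ℝ} (hu : StrictAnti u) :
    ∫ v, Lkern τ n u v = 1 := by
  rw [integral_eq_lintegral_of_nonneg_ae (Filter.Eventually.of_forall (Lkern_nonneg hτ u))
    ((measurable_Lkern τ n).comp measurable_prodMk_left).aestronglyMeasurable,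
    lintegral_Lkern hτ hu, ENNReal.toReal_one]

/-- The weight `z ^ (-α) * conj (z ^ (-α))`, for `z` in the slit plane. -/
noncomputable def powWeight (α z : ℂ) : ℝ := Real.exp (-2 * (α * Complex.log z).re)

theorem powWeight_pos (α z : ℂ) : 0 < powWeight α z := Real.exp_pos _

theorem abs_arg_one_add_mul_I (x : ℝ) : |Complex.arg (1 + x * Complex.I)| < Real.pi / 2 :=
  Complex.abs_arg_lt_pi_div_two_iff.2 (Or.inl (by simp))

theorem arg_one_add_mul_I (x : ℝ) : Complex.arg (1 + x * Complex.I) = Real.arctan x := by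
  have h := abs_lt.1 (abs_arg_one_add_mul_I x)
  rw [← Real.arctan_tan h.1 h.2, Complex.tan_arg]
  simp

theorem one_add_mul_I_ne_zero (x : ℝ) : (1 : ℂ) + x * Complex.I ≠ 0 := fun h => by
  simpa using congrArg Complex.re h

theorem re_cpow_mul_cpow_eq_powWeight (α : ℂ) (x : ℝ) :
    (((1 : ℂ) + (x : ℂ) * Complex.I) ^ (-α) *
      ((1 : ℂ) - (x : ℂ) * Complex.I) ^ (-(starRingEnd ℂ) α)).re =
      powWeight α (1 + x * Complex.I) := by
  have hz := one_add_mul_I_ne_zero x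
  have hc : (1 : ℂ) - (x : ℂ) * Complex.I = (starRingEnd ℂ) (1 + x * Complex.I) := by simp [sub_eq_add_neg]
  have harg : Complex.arg (1 + x * Complex.I) ≠ Real.pi := by
    have h := abs_lt.1 (abs_arg_one_add_mul_I x)
    have := Real.pi_pos
    linarith
  rw [hc, Complex.cpow_def_of_ne_zero hz, Complex.cpow_def_of_ne_zero ((map_ne_zero _).2 hz),
    Complex.log_conj _ harg, ← Complex.exp_add,
    show Complex.log (1 + x * Complex.I) * -α + (starRingEnd ℂ) (Complex.log (1 + x * Complex.I)) *
      -(starRingEnd ℂ) α = ((-2 * (α * Complex.log (1 + x * Complex.I)).re : ℝ) : ℂ) by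
        have := Complex.add_conj (α * Complex.log (1 + x * Complex.I))
        push_cast at this ⊢
        rw [neg_mul, ← this, map_mul]
        ring,
    ← Complex.ofReal_exp, Complex.ofReal_re, powWeight]

/-- The exponent `s + (N - 1) τ`. -/
noncomputable def sExponent (τ : ℝ) (s : ℂ) (N : ℕ) : ℂ := s + ((N : ℂ) - 1) * τ

theorem sDensity_of_strictAnti (τ : ℝ) (s : ℂ) {N : ℕ} {u : Fin N → ℝ} (hu : StrictAnti u) :
    sDensity τ s N u =
      (∏ k, powWeight (sExponent τ s N) (1 + u k * Complex.I)) * vand u ^ (2 * τ) := by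
  rw [sDensity, if_pos fun i j h => hu h, prod_rpow_eq_vand_rpow hu]
  congr 1
  refine Finset.prod_congr rfl fun k _ => ?_
  rw [← re_cpow_mul_cpow_eq_powWeight]
  congr 4 <;> simp [sExponent] <;> ring

theorem sDensity_of_not_strictAnti (τ : ℝ) (s : ℂ) {N : ℕ} {u : Fin N → ℝ} (hu : ¬StrictAnti u) :
    sDensity τ s N u = 0 :=
  if_neg fun h => hu fun i j hij => h i j hij

theorem sDensity_nonneg (τ : ℝ) (s : ℂ) {N : ℕ} (u : Fin N → ℝ) : 0 ≤ sDensity τ s N u := by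
  by_cases hu : StrictAnti u
  · rw [sDensity_of_strictAnti τ s hu]
    exact mul_nonneg (Finset.prod_nonneg fun k _ => (powWeight_pos _ _).le)
      (Real.rpow_nonneg (vand_pos hu).le _)
  · rw [sDensity_of_not_strictAnti τ s hu]

theorem measurable_sDensity (τ : ℝ) (s : ℂ) (N : ℕ) : Measurable (sDensity τ s N) := by
  refine Measurable.ite ?_ (Measurable.mul ?_ ?_) measurable_const
  · simp only [Set.ofPred_forall]
    exact MeasurableSet.iInter fun i => MeasurableSet.iInter fun j => MeasurableSet.iInter fun _ =>
      measurableSet_lt (measurable_pi_apply j) (measurable_pi_apply i)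
  · fun_prop
  · refine Finset.measurable_prod _ fun i _ => Finset.measurable_prod _ fun j _ => ?_
    split_ifs <;> fun_prop

theorem powWeight_add (α : ℂ) (τ x : ℝ) :
    powWeight (α + τ) (1 + x * Complex.I) =
      powWeight α (1 + x * Complex.I) * (1 + x ^ 2) ^ (-τ) := by
  have h : 0 < 1 + x ^ 2 := by positivity
  have hn : Real.log ‖(1 : ℂ) + x * Complex.I‖ = Real.log (1 + x ^ 2) / 2 := by
    have := Complex.norm_add_mul_I 1 x
    rw [Complex.ofReal_one] at this
    rw [this, Real.log_sqrt (by positivity), one_pow]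
  rw [powWeight, powWeight, Real.rpow_def_of_pos h, ← Real.exp_add, add_mul, Complex.add_re,
    Complex.re_ofReal_mul, Complex.log_re, hn]
  ring_nf

open Polynomial in
theorem prod_one_add_mul_I {n : ℕ} {v : Fin (n + 1) → ℝ} (hv : Function.Injective v)
    (u : Fin (n + 2) → ℝ) :
    ∏ j, ((1 : ℂ) + u j * Complex.I) = (1 + rootMap v u 0 * Complex.I) *
      ∏ i, ((1 : ℂ) + v i * Complex.I) +
      ∑ i : Fin (n + 1), (rootMap v u i.succ : ℂ) *
        ∏ k : Fin n, ((1 : ℂ) + v (i.succAbove k) * Complex.I) := by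
  have h := congrArg (aeval Complex.I) (rootMap_polynomial hv u)
  simp only [map_sub, map_mul, map_sum, map_prod, aeval_X, aeval_C, Complex.coe_algebraMap] at h
  have e : ∀ x : ℝ, Complex.I - x = Complex.I * (1 + x * Complex.I) := fun x => by
    linear_combination (-x : ℂ) * Complex.I_mul_I
  simp only [e, Finset.prod_mul_distrib, Finset.prod_const, Finset.card_univ, Fintype.card_fin] at h
  refine mul_left_cancel₀ (pow_ne_zero (n + 2) Complex.I_ne_zero) (h.trans ?_)
  rw [mul_add (Complex.I ^ (n + 2)), Finset.mul_sum, sub_eq_add_neg, ← Finset.sum_neg_distrib]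
  congr 1
  · ring
  · refine Finset.sum_congr rfl fun i _ => ?_
    rw [pow_add, Complex.I_sq]
    ring

/-- The coordinates in which `∏ (1 + u j * I) / ∏ (1 + v i * I)` is `1 + ∑ w i + a * I`. -/
noncomputable def shearMatrix {n : ℕ} (v : Fin (n + 1) → ℝ) : Matrix (Fin (n + 2)) (Fin (n + 2)) ℝ :=
  Matrix.of (Fin.cons (Fin.cons 1 fun i => -(v i * (1 + v i ^ 2)⁻¹))
    fun i => Pi.single i.succ (1 + v i ^ 2)⁻¹)

theorem shearMatrix_mulVec_zero {n : ℕ} (v : Fin (n + 1) → ℝ) (y : Fin (n + 2) → ℝ) :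
    (shearMatrix v).toLin' y 0 = y 0 - ∑ i : Fin (n + 1), v i * (1 + v i ^ 2)⁻¹ * y i.succ := by
  simp [shearMatrix, Matrix.mulVec, dotProduct, Fin.sum_univ_succ, sub_eq_add_neg]

theorem shearMatrix_mulVec_succ {n : ℕ} (v : Fin (n + 1) → ℝ) (y : Fin (n + 2) → ℝ)
    (i : Fin (n + 1)) : (shearMatrix v).toLin' y i.succ = (1 + v i ^ 2)⁻¹ * y i.succ := by
  simp [shearMatrix, Matrix.mulVec]

theorem det_shearMatrix {n : ℕ} (v : Fin (n + 1) → ℝ) :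
    (shearMatrix v).det = ∏ i, (1 + v i ^ 2)⁻¹ := by
  rw [Matrix.det_of_isUpperTriangular, Fin.prod_univ_succ]
  · simp [shearMatrix]
  · intro i j h
    obtain ⟨i, rfl⟩ := Fin.exists_succ_eq.2 (ne_of_gt (lt_of_le_of_lt (Fin.zero_le j) h))
    simp only [shearMatrix, Matrix.of_apply, Fin.cons_succ]
    exact Pi.single_eq_of_ne (ne_of_lt h) _

theorem one_add_sq_pos (x : ℝ) : 0 < 1 + x ^ 2 := by positivity

theorem injective_shearMatrix {n : ℕ} (v : Fin (n + 1) → ℝ) :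
    Function.Injective (shearMatrix v).toLin' := by
  intro x y h
  have hs : ∀ i : Fin (n + 1), x i.succ = y i.succ := fun i => by
    have := congrFun h i.succ
    rw [shearMatrix_mulVec_succ, shearMatrix_mulVec_succ] at this
    exact mul_left_cancel₀ (inv_ne_zero (one_add_sq_pos _).ne') this
  ext j
  refine Fin.cases ?_ hs j
  have := congrFun h 0
  rw [shearMatrix_mulVec_zero, shearMatrix_mulVec_zero] at this
  simp only [hs] at this
  linarith

theorem image_shearMatrix {n : ℕ} (v : Fin (n + 1) → ℝ) :
    (shearMatrix v).toLin' '' {y | ∀ i : Fin (n + 1), 0 < y i.succ} =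
      {y | ∀ i : Fin (n + 1), 0 < y i.succ} := by
  ext y
  constructor
  · rintro ⟨x, hx, rfl⟩ i
    rw [shearMatrix_mulVec_succ]
    exact mul_pos (inv_pos.2 (one_add_sq_pos _)) (hx i)
  · intro hy
    refine ⟨Fin.cons (y 0 + ∑ i : Fin (n + 1), v i * y i.succ) fun i => (1 + v i ^ 2) * y i.succ,
      fun i => by simpa using mul_pos (one_add_sq_pos _) (hy i), ?_⟩
    ext j
    refine Fin.cases ?_ (fun i => ?_) j
    · rw [shearMatrix_mulVec_zero]
      simp only [Fin.cons_zero, Fin.cons_succ]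
      rw [add_sub_assoc, ← Finset.sum_sub_distrib, Finset.sum_eq_zero, add_zero]
      intro i _
      have := one_add_sq_pos (v i)
      field_simp
      ring
    · rw [shearMatrix_mulVec_succ, Fin.cons_succ, inv_mul_cancel_left₀ (one_add_sq_pos _).ne']

/-- The complex number `1 + ∑ w i + a * I`. -/
noncomputable def shiftPoint {n : ℕ} (y : Fin (n + 1) → ℝ) : ℂ :=
  ((1 + ∑ i : Fin n, y i.succ : ℝ) : ℂ) + y 0 * Complex.I

theorem prod_one_add_mul_I_eq_shiftPoint {n : ℕ} {v : Fin (n + 1) → ℝ} (hv : Function.Injective v)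
    (u : Fin (n + 2) → ℝ) :
    ∏ j, ((1 : ℂ) + u j * Complex.I) = (∏ i, ((1 : ℂ) + v i * Complex.I)) *
      shiftPoint ((shearMatrix v).toLin' (rootMap v u)) := by
  rw [prod_one_add_mul_I hv, shiftPoint, shearMatrix_mulVec_zero]
  simp only [shearMatrix_mulVec_succ]
  push_cast
  rw [show ∀ (P a S T : ℂ), P * (1 + S + (a - T) * Complex.I) =
    (1 + a * Complex.I) * P + P * (S - T * Complex.I) by intros; ring]
  congr 1
  rw [Finset.sum_mul, ← Finset.sum_sub_distrib, Finset.mul_sum]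
  refine Finset.sum_congr rfl fun i _ => ?_
  have h1 : ((1 : ℂ) + v i ^ 2) ≠ 0 := by exact_mod_cast (one_add_sq_pos (v i)).ne'
  rw [Fin.prod_univ_succAbove _ i]
  generalize ∏ k : Fin n, ((1 : ℂ) + v (i.succAbove k) * Complex.I) = R
  field_simp
  linear_combination (rootMap v u i.succ * R * (v i : ℂ) ^ 2) * Complex.I_sq

theorem Interlace.log_shiftPoint {n : ℕ} {u : Fin (n + 2) → ℝ} {v : Fin (n + 1) → ℝ}
    (h : Interlace n u v) :
    Complex.log (shiftPoint ((shearMatrix v).toLin' (rootMap v u))) =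
      ∑ j, Complex.log (1 + u j * Complex.I) - ∑ i, Complex.log (1 + v i * Complex.I) := by
  have hv := (strictAnti_of_interlace h).2.injective
  have hne : ∏ i, ((1 : ℂ) + v i * Complex.I) ≠ 0 :=
    Finset.prod_ne_zero_iff.2 fun i _ => one_add_mul_I_ne_zero _
  have hexp : Complex.exp (∑ j, Complex.log (1 + u j * Complex.I) -
      ∑ i, Complex.log (1 + v i * Complex.I)) =
      shiftPoint ((shearMatrix v).toLin' (rootMap v u)) := by
    rw [Complex.exp_sub, Complex.exp_sum, Complex.exp_sum]
    simp only [Complex.exp_log (one_add_mul_I_ne_zero _)]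
    rw [prod_one_add_mul_I_eq_shiftPoint hv, mul_div_cancel_left₀ _ hne]
  have him : (∑ j, Complex.log (1 + u j * Complex.I) -
      ∑ i, Complex.log (1 + v i * Complex.I)).im = ∑ j, Real.arctan (u j) - ∑ i, Real.arctan (v i) := by
    simp only [Complex.sub_im, Complex.im_sum, Complex.log_im, arg_one_add_mul_I]
  have hpi := Real.pi_pos
  rw [← hexp, Complex.log_exp]
  · rw [him, Fin.sum_univ_castSucc]
    have h1 : ∑ i, Real.arctan (v i) ≤ ∑ i : Fin (n + 1), Real.arctan (u i.castSucc) :=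
      Finset.sum_le_sum fun i _ => (Real.arctan_strictMono (h i).1).le
    have := Real.neg_pi_div_two_lt_arctan (u (Fin.last (n + 1)))
    linarith
  · rw [him, Fin.sum_univ_succ]
    have h1 : ∑ i : Fin (n + 1), Real.arctan (u i.succ) ≤ ∑ i, Real.arctan (v i) :=
      Finset.sum_le_sum fun i _ => (Real.arctan_strictMono (h i).2).le
    have := Real.arctan_lt_pi_div_two (u 0)
    linarith

theorem Interlace.prod_powWeight {n : ℕ} {u : Fin (n + 2) → ℝ} {v : Fin (n + 1) → ℝ}
    (h : Interlace n u v) (α : ℂ) :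
    ∏ j, powWeight α (1 + u j * Complex.I) = (∏ i, powWeight α (1 + v i * Complex.I)) *
      powWeight α (shiftPoint ((shearMatrix v).toLin' (rootMap v u))) := by
  simp only [powWeight, ← Real.exp_sum, ← Real.exp_add, h.log_shiftPoint, ← Finset.mul_sum,
    ← Complex.re_sum, mul_sub, Complex.sub_re]
  congr 1
  linarith

theorem Interlace.rootMap_succ_pos {n : ℕ} {u : Fin (n + 2) → ℝ} {v : Fin (n + 1) → ℝ}
    (h : Interlace n u v) (i : Fin (n + 1)) : 0 < rootMap v u i.succ :=
  (image_rootMap (strictAnti_of_interlace h).2).subset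
    (Set.mem_image_of_mem (rootMap v) (show u ∈ {u | Interlace n u v} from h)) i

theorem Interlace.prod_rootMap {n : ℕ} {u : Fin (n + 2) → ℝ} {v : Fin (n + 1) → ℝ}
    (h : Interlace n u v) :
    ∏ i : Fin (n + 1), rootMap v u i.succ = (∏ i, ∏ j, |v i - u j|) / vand v ^ 2 := by
  have hp : ∏ i : Fin (n + 1), rootMap v u i.succ = |∏ i : Fin (n + 1), rootMap v u i.succ| :=
    (abs_of_pos (Finset.prod_pos fun i _ => h.rootMap_succ_pos i)).symm
  rw [hp, Finset.abs_prod, ← prod_abs_nodeDeriv (strictAnti_of_interlace h).2]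
  simp only [rootMap, Fin.cons_succ, abs_mul, abs_neg, abs_inv, Finset.abs_prod,
    Finset.prod_mul_distrib, Finset.prod_inv_distrib, div_eq_mul_inv]

/-- The weight on the cone of pairs `(a, w)` with all `w i > 0`. -/
noncomputable def coneWeight (τ : ℝ) (α : ℂ) {n : ℕ} (y : Fin (n + 1) → ℝ) : ℝ :=
  powWeight α (shiftPoint y) * ∏ i : Fin n, y i.succ ^ (τ - 1)

theorem Interlace.sDensity_mul_interlaceWeight {n : ℕ} {u : Fin (n + 2) → ℝ} {v : Fin (n + 1) → ℝ}
    (h : Interlace n u v) (τ : ℝ) (s : ℂ) :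
    sDensity τ s (n + 2) u * interlaceWeight τ u v = sDensity τ s (n + 1) v *
      (|(rootJacobian v u).det| * (|(shearMatrix v).det| *
        coneWeight τ (sExponent τ s (n + 2)) ((shearMatrix v).toLin' (rootMap v u)))) := by
  obtain ⟨hu, hv⟩ := strictAnti_of_interlace h
  have hU := vand_pos hu
  have hV := vand_pos hv
  have hα : sExponent τ s (n + 2) = sExponent τ s (n + 1) + τ := by
    simp only [sExponent]
    push_cast
    ring
  set P := ∏ i, ∏ j, |v i - u j| with hPdef
  have hP : 0 < P := Finset.prod_pos fun i _ => Finset.prod_pos fun j _ => h.prod_abs_pos i j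
  have hPp : ∏ i, ∏ j, |v i - u j| ^ (τ - 1) = P ^ (τ - 1) := by
    rw [hPdef, ← Real.finsetProd_rpow _ _ fun i _ => Finset.prod_nonneg fun j _ => abs_nonneg _]
    exact Finset.prod_congr rfl fun i _ => Real.finsetProd_rpow _ _ (fun j _ => abs_nonneg _) _
  set Q := ∏ i, (1 + v i ^ 2) with hQdef
  have hQ : 0 < Q := Finset.prod_pos fun i _ => one_add_sq_pos _
  have hw : ∏ i : Fin (n + 1), (shearMatrix v).toLin' (rootMap v u) i.succ ^ (τ - 1) =
      Q⁻¹ ^ (τ - 1) * (P / vand v ^ 2) ^ (τ - 1) := by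
    rw [← h.prod_rootMap, ← Real.mul_rpow (by positivity)
      (Finset.prod_nonneg fun i _ => (h.rootMap_succ_pos i).le), hQdef, ← Finset.prod_inv_distrib,
      ← Finset.prod_mul_distrib, ← Real.finsetProd_rpow _ _ fun i _ =>
        mul_nonneg (inv_nonneg.2 (one_add_sq_pos _).le) (h.rootMap_succ_pos i).le]
    simp only [shearMatrix_mulVec_succ]
  have hΩ : ∏ i, powWeight (sExponent τ s (n + 2)) (1 + v i * Complex.I) =
      (∏ i, powWeight (sExponent τ s (n + 1)) (1 + v i * Complex.I)) * Q ^ (-τ) := by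
    simp only [hα, powWeight_add, Finset.prod_mul_distrib]
    rw [Real.finsetProd_rpow _ _ fun i _ => (one_add_sq_pos (v i)).le]
  rw [sDensity_of_strictAnti τ s hu, sDensity_of_strictAnti τ s hv, h.prod_powWeight, hΩ,
    abs_det_rootJacobian h, det_shearMatrix, Finset.prod_inv_distrib, ← hQdef,
    abs_of_pos (inv_pos.2 hQ), coneWeight, hw, interlaceWeight, hPp,
    Real.div_rpow hP.le (by positivity), ← Real.rpow_natCast_mul hV.le,
    Real.inv_rpow hQ.le, ← Real.rpow_neg hQ.le]
  have e1 : vand u ^ (2 * τ) * vand u ^ (1 - 2 * τ) = vand u := by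
    rw [← Real.rpow_add hU, show 2 * τ + (1 - 2 * τ) = 1 by ring, Real.rpow_one]
  have e2 : vand v ^ (2 * τ) = vand v ^ (((2 : ℕ) : ℝ) * (τ - 1)) * vand v * vand v := by
    rw [show 2 * τ = ((2 : ℕ) : ℝ) * (τ - 1) + 1 + 1 by push_cast; ring, Real.rpow_add_one hV.ne',
      Real.rpow_add_one hV.ne']
  have e3 : Q ^ (-τ) = Q ^ (-(τ - 1)) * Q⁻¹ := by
    rw [← Real.rpow_neg_one, ← Real.rpow_add hQ]
    ring_nf
  rw [e3, e2]
  have hr : 0 < vand v ^ (((2 : ℕ) : ℝ) * (τ - 1)) := Real.rpow_pos_of_pos hV _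
  rw [show ∀ a b c d e f g : ℝ, a * b * c * d * (e * f * g) = a * b * c * (d * e) * f * g by
    intros; ring, e1]
  generalize ∏ i, powWeight (sExponent τ s (n + 1)) (1 + v i * Complex.I) = A
  field_simp

/-- The total mass of `coneWeight`. -/
noncomputable def coneMass (τ : ℝ) (α : ℂ) (n : ℕ) : ENNReal :=
  ∫⁻ y in {y : Fin (n + 1) → ℝ | ∀ i : Fin n, 0 < y i.succ}, ENNReal.ofReal (coneWeight τ α y)

theorem measurableSet_cone (n : ℕ) :
    MeasurableSet {y : Fin (n + 1) → ℝ | ∀ i : Fin n, 0 < y i.succ} := by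
  simp only [Set.ofPred_forall]
  exact MeasurableSet.iInter fun i => measurableSet_lt measurable_const (measurable_pi_apply _)

theorem measurable_shiftPoint (n : ℕ) : Measurable (shiftPoint : (Fin (n + 1) → ℝ) → ℂ) := by
  unfold shiftPoint
  fun_prop

theorem measurable_coneWeight (τ : ℝ) (α : ℂ) (n : ℕ) :
    Measurable (coneWeight τ α : (Fin (n + 1) → ℝ) → ℝ) := by
  have := measurable_shiftPoint n
  unfold coneWeight powWeight
  fun_prop

open MeasureTheory in
theorem lintegral_shearMatrix (τ : ℝ) (α : ℂ) {n : ℕ} (v : Fin (n + 1) → ℝ) :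
    ∫⁻ y in {y : Fin (n + 2) → ℝ | ∀ i : Fin (n + 1), 0 < y i.succ},
      ENNReal.ofReal (|(shearMatrix v).det| * coneWeight τ α ((shearMatrix v).toLin' y)) =
      coneMass τ α (n + 1) := by
  have h := lintegral_image_eq_lintegral_abs_det_fderiv_mul volume (measurableSet_cone (n + 1))
    (fun x _ => (LinearMap.toContinuousLinearMap (shearMatrix v).toLin').hasFDerivAt.hasFDerivWithinAt)
    (injective_shearMatrix v).injOn fun y => ENNReal.ofReal (coneWeight τ α y)
  rw [LinearMap.coe_toContinuousLinearMap', image_shearMatrix] at h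
  rw [coneMass, h]
  refine lintegral_congr fun y => ?_
  rw [ENNReal.ofReal_mul (abs_nonneg _), LinearMap.det_toContinuousLinearMap, LinearMap.det_toLin']

open MeasureTheory in
theorem lintegral_sDensity_mul_Lkern {τ : ℝ} (hτ : 0 < τ) (s : ℂ) {n : ℕ} (v : Fin (n + 1) → ℝ) :
    ∫⁻ u, ENNReal.ofReal (sDensity τ s (n + 2) u * Lkern τ n u v) =
      ENNReal.ofReal (Real.Gamma ((n + 2 : ℝ) * τ) / Real.Gamma τ ^ (n + 2)) *
        coneMass τ (sExponent τ s (n + 2)) (n + 1) * ENNReal.ofReal (sDensity τ s (n + 1) v) := by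
  have hI : MeasurableSet {u | Interlace n u v} := measurable_prodMk_right (measurableSet_interlace n)
  have hG := Real.Gamma_pos_of_pos hτ
  have hG' : 0 < Real.Gamma ((n + 2 : ℝ) * τ) := Real.Gamma_pos_of_pos (by positivity)
  set c := Real.Gamma ((n + 2 : ℝ) * τ) / Real.Gamma τ ^ (n + 2) with hc
  have hc0 : 0 ≤ c := by positivity
  by_cases hv : StrictAnti v
  · have hcov := lintegral_image_eq_lintegral_abs_det_fderiv_mul volume hI
      (fun u _ => (hasFDerivAt_rootMap v u).hasFDerivWithinAt) (injOn_rootMap v)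
      fun y => ENNReal.ofReal (|(shearMatrix v).det| *
        coneWeight τ (sExponent τ s (n + 2)) ((shearMatrix v).toLin' y))
    rw [image_rootMap hv, lintegral_shearMatrix] at hcov
    rw [hcov, mul_right_comm, ← ENNReal.ofReal_mul hc0, ← lintegral_const_mul' _ _ (by simp),
      ← lintegral_indicator hI]
    refine lintegral_congr fun u => ?_
    by_cases hu : Interlace n u v
    · rw [Set.indicator_of_mem (by exact hu), LinearMap.det_toContinuousLinearMap,
        LinearMap.det_toLin', ← ENNReal.ofReal_mul (abs_nonneg _), ← ENNReal.ofReal_mul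
          (mul_nonneg hc0 (sDensity_nonneg _ _ _)), Lkern_of_interlace τ hu, mul_assoc c,
        ← hu.sDensity_mul_interlaceWeight, ← hc]
      congr 1
      ring
    · rw [Set.indicator_of_notMem (by exact hu), Lkern, if_neg hu, mul_zero, ENNReal.ofReal_zero]
  · rw [sDensity_of_not_strictAnti τ s hv, ENNReal.ofReal_zero, mul_zero, lintegral_eq_zero_iff']
    · refine Filter.Eventually.of_forall fun u => ?_
      have hu : ¬Interlace n u v := fun h => hv (strictAnti_of_interlace h).2
      simp [Lkern, if_neg hu]
    · exact (((measurable_sDensity τ s _).mul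
        ((measurable_Lkern τ n).comp measurable_prodMk_right)).ennreal_ofReal).aemeasurable

theorem shiftPoint_re {n : ℕ} (y : Fin (n + 1) → ℝ) :
    (shiftPoint y).re = 1 + ∑ i : Fin n, y i.succ := by
  rw [shiftPoint, Complex.add_re, Complex.ofReal_re, Complex.re_ofReal_mul, Complex.I_re, mul_zero,
    add_zero]

theorem shiftPoint_im {n : ℕ} (y : Fin (n + 1) → ℝ) : (shiftPoint y).im = y 0 := by
  rw [shiftPoint, Complex.add_im, Complex.ofReal_im, Complex.im_ofReal_mul, Complex.I_im, mul_one,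
    zero_add]

theorem powWeight_le {α z : ℂ} (hz : z ≠ 0) :
    powWeight α z ≤ Real.exp (2 * (Real.pi * |α.im|)) * ‖z‖ ^ (-(2 * α.re)) := by
  rw [powWeight, Real.rpow_def_of_pos (norm_pos_iff.2 hz), ← Real.exp_add, Complex.mul_re,
    Complex.log_re, Complex.log_im, Real.exp_le_exp]
  have h1 : α.im * z.arg ≤ Real.pi * |α.im| := by
    refine (le_abs_self _).trans ?_
    rw [abs_mul, mul_comm]
    exact mul_le_mul_of_nonneg_right (Complex.abs_arg_le_pi z) (abs_nonneg _)
  linarith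

theorem coneWeight_le {τ σ : ℝ} (hτ : 0 < τ) (hσ : 0 < σ) {α : ℂ} {n : ℕ} (hα : α.re = σ + n * τ)
    {y : Fin (n + 1) → ℝ} (hy : ∀ i : Fin n, 0 < y i.succ) :
    coneWeight τ α y ≤ Real.exp (2 * (Real.pi * |α.im|)) * ((1 + y 0 ^ 2) ^ (-σ) *
      ∏ i : Fin n, (y i.succ ^ (τ - 1) * (1 + y i.succ) ^ (-(2 * τ)))) := by
  have hW : ∀ i : Fin n, y i.succ ≤ ∑ i : Fin n, y i.succ := fun i =>
    Finset.single_le_sum (f := fun i : Fin n => y i.succ) (fun i _ => (hy i).le) (Finset.mem_univ i)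
  have hW0 : 0 ≤ ∑ i : Fin n, y i.succ := Finset.sum_nonneg fun i _ => (hy i).le
  have hre : 1 + ∑ i : Fin n, y i.succ ≤ ‖shiftPoint y‖ := by
    rw [← shiftPoint_re]
    exact Complex.re_le_norm _
  have hz : 0 < ‖shiftPoint y‖ := by linarith
  have h1 : 1 + y 0 ^ 2 ≤ ‖shiftPoint y‖ ^ 2 := by
    rw [Complex.sq_norm, Complex.normSq_apply, shiftPoint_re, shiftPoint_im]
    nlinarith
  have h2 : ‖shiftPoint y‖ ^ (-(2 * α.re)) ≤ (1 + y 0 ^ 2) ^ (-σ) *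
      ∏ i : Fin n, (1 + y i.succ) ^ (-(2 * τ)) := by
    rw [show -(2 * α.re) = ((2 : ℕ) : ℝ) * (-σ) + (-(2 * τ)) * n by rw [hα]; push_cast; ring,
      Real.rpow_add hz, Real.rpow_natCast_mul hz.le, Real.rpow_mul_natCast hz.le]
    refine mul_le_mul (Real.rpow_le_rpow_of_nonpos (by positivity) h1 (by linarith)) ?_
      (by positivity) (by positivity)
    rw [← Fin.prod_const n]
    refine Finset.prod_le_prod (fun i _ => by positivity) fun i _ => ?_
    exact Real.rpow_le_rpow_of_nonpos (by linarith [hy i]) (by linarith [hW i]) (by linarith)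
  rw [coneWeight, Finset.prod_mul_distrib]
  have hp : 0 ≤ ∏ i : Fin n, y i.succ ^ (τ - 1) :=
    Finset.prod_nonneg fun i _ => Real.rpow_nonneg (hy i).le _
  calc _ ≤ Real.exp (2 * (Real.pi * |α.im|)) * ((1 + y 0 ^ 2) ^ (-σ) *
      ∏ i : Fin n, (1 + y i.succ) ^ (-(2 * τ))) * ∏ i : Fin n, y i.succ ^ (τ - 1) :=
        mul_le_mul_of_nonneg_right ((powWeight_le (norm_pos_iff.1 hz)).trans
          (mul_le_mul_of_nonneg_left h2 (Real.exp_pos _).le)) hp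
    _ = _ := by ring

open MeasureTheory in
theorem lintegral_one_add_sq_rpow_lt_top {σ : ℝ} (hσ : 1 / 2 < σ) :
    ∫⁻ a : ℝ, ENNReal.ofReal ((1 + a ^ 2) ^ (-σ)) < ⊤ := by
  have h := (integrable_rpow_neg_one_add_norm_sq (E := ℝ) (μ := volume) (r := 2 * σ)
    (by rw [Module.finrank_self]; push_cast; linarith)).lintegral_lt_top
  simpa [neg_div] using h

open MeasureTheory in
theorem lintegral_beta_prime_lt_top {τ : ℝ} (hτ : 0 < τ) :
    ∫⁻ x in Set.Ioi (0 : ℝ), ENNReal.ofReal (x ^ (τ - 1) * (1 + x) ^ (-(2 * τ))) < ⊤ := by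
  rw [← Set.Ioc_union_Ioi_eq_Ioi (zero_le_one' ℝ)]
  refine (lintegral_union_le _ _ _).trans_lt (ENNReal.add_lt_top.2 ⟨?_, ?_⟩)
  · have h : IntervalIntegrable (fun x : ℝ => x ^ (τ - 1)) volume 0 1 :=
      intervalIntegral.intervalIntegrable_rpow' (by linarith)
    rw [intervalIntegrable_iff_integrableOn_Ioc_of_le zero_le_one] at h
    refine (setLIntegral_mono' measurableSet_Ioc fun x hx => ?_).trans_lt h.lintegral_lt_top
    exact ENNReal.ofReal_le_ofReal (mul_le_of_le_one_right (Real.rpow_nonneg hx.1.le _)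
      (Real.rpow_le_one_of_one_le_of_nonpos (by linarith [hx.1]) (by linarith)))
  · have h : IntegrableOn (fun x : ℝ => x ^ (-τ - 1)) (Set.Ioi 1) :=
      integrableOn_Ioi_rpow_of_lt (by linarith) one_pos
    refine (setLIntegral_mono' measurableSet_Ioi fun x hx => ?_).trans_lt h.lintegral_lt_top
    have hx0 : 0 < x := one_pos.trans hx
    refine ENNReal.ofReal_le_ofReal ?_
    rw [show -τ - 1 = (τ - 1) + -(2 * τ) by ring, Real.rpow_add hx0]
    exact mul_le_mul_of_nonneg_left
      (Real.rpow_le_rpow_of_nonpos hx0 (by linarith) (by linarith)) (Real.rpow_nonneg hx0.le _)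

open MeasureTheory in
theorem coneMass_lt_top {τ σ : ℝ} (hτ : 0 < τ) (hσ : 1 / 2 < σ) {α : ℂ} {n : ℕ}
    (hα : α.re = σ + n * τ) : coneMass τ α n < ⊤ := by
  set f : Fin (n + 1) → ℝ → ENNReal := Fin.cons (fun a => ENNReal.ofReal ((1 + a ^ 2) ^ (-σ)))
    fun _ => (Set.Ioi 0).indicator fun x => ENNReal.ofReal (x ^ (τ - 1) * (1 + x) ^ (-(2 * τ))) with hf
  have hfm : ∀ j, Measurable (f j) := fun j => by
    refine Fin.cases ?_ (fun i => ?_) j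
    · simp only [hf, Fin.cons_zero]
      fun_prop
    · simp only [hf, Fin.cons_succ]
      exact Measurable.indicator (by fun_prop) measurableSet_Ioi
  have hle : coneMass τ α n ≤
      ENNReal.ofReal (Real.exp (2 * (Real.pi * |α.im|))) * ∫⁻ y : Fin (n + 1) → ℝ, ∏ j, f j (y j) := by
    rw [← lintegral_const_mul' _ _ (by simp), coneMass, ← lintegral_indicator (measurableSet_cone n)]
    refine lintegral_mono fun y => ?_
    by_cases hy : ∀ i : Fin n, 0 < y i.succ
    · rw [Set.indicator_of_mem (by exact hy)]
      refine (ENNReal.ofReal_le_ofReal (coneWeight_le hτ (by linarith) hα hy)).trans (le_of_eq ?_)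
      rw [ENNReal.ofReal_mul (by positivity), ENNReal.ofReal_mul (by positivity),
        ENNReal.ofReal_prod_of_nonneg fun i _ => by have := hy i; positivity, Fin.prod_univ_succ]
      simp only [hf, Fin.cons_zero, Fin.cons_succ]
      refine congrArg _ (congrArg _ (Finset.prod_congr rfl fun i _ => ?_))
      rw [Set.indicator_of_mem (by exact hy i)]
    · rw [Set.indicator_of_notMem (by exact hy)]
      exact zero_le
  refine hle.trans_lt (ENNReal.mul_lt_top ENNReal.ofReal_lt_top ?_)
  rw [lintegral_fin_prod hfm]
  refine ENNReal.prod_lt_top fun j _ => ?_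
  refine Fin.cases ?_ (fun i => ?_) j
  · simpa only [hf, Fin.cons_zero] using lintegral_one_add_sq_rpow_lt_top hσ
  · simp only [hf, Fin.cons_succ]
    rw [lintegral_indicator measurableSet_Ioi]
    exact lintegral_beta_prime_lt_top hτ

open MeasureTheory in
theorem coneMass_ne_zero (τ : ℝ) (α : ℂ) (n : ℕ) : coneMass τ α n ≠ 0 := by
  rw [coneMass, ← pos_iff_ne_zero,
    setLIntegral_pos_iff (measurable_coneWeight τ α n).ennreal_ofReal]
  have hopen : IsOpen {y : Fin (n + 1) → ℝ | ∀ i : Fin n, 0 < y i.succ} := by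
    simp only [Set.ofPred_forall]
    exact isOpen_iInter_of_finite fun i => isOpen_lt continuous_const (continuous_apply _)
  refine (hopen.measure_pos volume ⟨fun _ => 1, fun _ => one_pos⟩).trans_le (measure_mono fun y hy => ?_)
  refine ⟨?_, hy⟩
  rw [Function.mem_support, ← pos_iff_ne_zero, ENNReal.ofReal_pos]
  exact mul_pos (powWeight_pos _ _) (Finset.prod_pos fun i _ => Real.rpow_pos_of_pos (hy i) _)

theorem sExponent_re (τ : ℝ) (s : ℂ) (n : ℕ) : (sExponent τ s (n + 1)).re = s.re + n * τ := by
  simp [sExponent]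

open MeasureTheory in
theorem lintegral_sDensity_mul_lintegral_Lkern {τ : ℝ} (hτ : 0 < τ) (s : ℂ) (n : ℕ) :
    ∫⁻ v, ∫⁻ u, ENNReal.ofReal (sDensity τ s (n + 2) u * Lkern τ n u v) =
      ∫⁻ u, ENNReal.ofReal (sDensity τ s (n + 2) u) := by
  rw [lintegral_lintegral_swap]
  · refine lintegral_congr fun u => ?_
    simp only [ENNReal.ofReal_mul (sDensity_nonneg τ s u)]
    rw [lintegral_const_mul' _ _ (by simp)]
    by_cases hu : StrictAnti u
    · rw [lintegral_Lkern hτ hu, mul_one]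
    · rw [sDensity_of_not_strictAnti τ s hu, ENNReal.ofReal_zero, zero_mul]
  · exact ((((measurable_sDensity τ s _).comp measurable_snd).mul
      ((measurable_Lkern τ n).comp measurable_swap)).ennreal_ofReal).aemeasurable

open MeasureTheory in
theorem lintegral_sDensity_lt_top {τ : ℝ} (hτ : 0 < τ) {s : ℂ} (hs : 1 / 2 < s.re) (n : ℕ) :
    ∫⁻ u, ENNReal.ofReal (sDensity τ s (n + 1) u) < ⊤ := by
  induction n with
  | zero =>
    have h := coneMass_lt_top hτ hs (sExponent_re τ s 0)
    have hset : {y : Fin (0 + 1) → ℝ | ∀ i : Fin 0, 0 < y i.succ} = Set.univ :=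
      Set.eq_univ_of_forall fun y i => i.elim0
    rw [coneMass, hset, setLIntegral_univ] at h
    refine (lintegral_congr fun u => ?_).trans_lt h
    have hu : StrictAnti u := fun i j hij => absurd hij (by omega)
    rw [sDensity_of_strictAnti τ s hu]
    simp [coneWeight, shiftPoint, vand]
  | succ n ih =>
    rw [← lintegral_sDensity_mul_lintegral_Lkern hτ]
    simp only [lintegral_sDensity_mul_Lkern hτ]
    rw [lintegral_const_mul _ (measurable_sDensity τ s _).ennreal_ofReal]
    exact ENNReal.mul_lt_top (ENNReal.mul_lt_top ENNReal.ofReal_lt_top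
      (coneMass_lt_top hτ hs (sExponent_re τ s (n + 1)))) ih

open MeasureTheory in
theorem integrable_sDensity_mul_Lkern {τ : ℝ} (hτ : 0 < τ) {s : ℂ} (hs : 1 / 2 < s.re) (n : ℕ) :
    Integrable fun p : (Fin (n + 2) → ℝ) × (Fin (n + 1) → ℝ) =>
      sDensity τ s (n + 2) p.1 * Lkern τ n p.1 p.2 := by
  have hm : Measurable fun p : (Fin (n + 2) → ℝ) × (Fin (n + 1) → ℝ) =>
      sDensity τ s (n + 2) p.1 * Lkern τ n p.1 p.2 :=
    ((measurable_sDensity τ s _).comp measurable_fst).mul (measurable_Lkern τ n)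
  refine ⟨hm.aestronglyMeasurable, ?_⟩
  rw [hasFiniteIntegral_iff_ofReal (Filter.Eventually.of_forall fun p =>
      mul_nonneg (sDensity_nonneg τ s _) (Lkern_nonneg hτ _ _)), Measure.volume_eq_prod,
    lintegral_prod_symm _ hm.ennreal_ofReal.aemeasurable,
    lintegral_sDensity_mul_lintegral_Lkern hτ]
  exact lintegral_sDensity_lt_top hτ hs (n + 1)

open MeasureTheory in
theorem integral_sMeasure (τ : ℝ) (s : ℂ) (N : ℕ) (g : (Fin N → ℝ) → ℝ) :
    ∫ u, g u ∂(sMeasure τ s N) = (∫ u, sDensity τ s N u)⁻¹ * ∫ u, sDensity τ s N u * g u := by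
  rw [sMeasure, integral_smul_measure, integral_withDensity_eq_integral_toReal_smul
    (measurable_sDensity τ s N).ennreal_ofReal (Filter.Eventually.of_forall fun _ =>
      ENNReal.ofReal_lt_top), ENNReal.toReal_inv,
    ENNReal.toReal_ofReal (integral_nonneg fun u => sDensity_nonneg τ s u), smul_eq_mul]
  simp only [ENNReal.toReal_ofReal (sDensity_nonneg τ s _), smul_eq_mul]

open MeasureTheory in
theorem exists_integral_sDensity_mul_Lkern {τ : ℝ} (hτ : 0 < τ) {s : ℂ} (hs : 1 / 2 < s.re) (n : ℕ) :
    ∃ c : ℝ, c ≠ 0 ∧ ∀ v, ∫ u, sDensity τ s (n + 2) u * Lkern τ n u v =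
      c * sDensity τ s (n + 1) v := by
  have hG := Real.Gamma_pos_of_pos hτ
  have hG' : 0 < Real.Gamma ((n + 2 : ℝ) * τ) := Real.Gamma_pos_of_pos (by positivity)
  refine ⟨(ENNReal.ofReal (Real.Gamma ((n + 2 : ℝ) * τ) / Real.Gamma τ ^ (n + 2)) *
    coneMass τ (sExponent τ s (n + 2)) (n + 1)).toReal, ?_, fun v => ?_⟩
  · rw [ENNReal.toReal_mul]
    refine mul_ne_zero ?_ (ENNReal.toReal_ne_zero.2 ⟨coneMass_ne_zero _ _ _,
      (coneMass_lt_top hτ hs (sExponent_re τ s (n + 1))).ne⟩)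
    rw [ENNReal.toReal_ofReal (by positivity)]
    positivity
  · rw [integral_eq_lintegral_of_nonneg_ae (Filter.Eventually.of_forall fun u =>
        mul_nonneg (sDensity_nonneg τ s u) (Lkern_nonneg hτ u v))
      ((measurable_sDensity τ s _).mul
        ((measurable_Lkern τ n).comp measurable_prodMk_right)).aestronglyMeasurable,
      lintegral_sDensity_mul_Lkern hτ, ENNReal.toReal_mul,
      ENNReal.toReal_ofReal (sDensity_nonneg τ s v)]

open MeasureTheory in
theorem integral_sDensity_mul_integral_Lkern {τ : ℝ} (hτ : 0 < τ) {s : ℂ} (hs : 1 / 2 < s.re) {n : ℕ}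
    {c : ℝ} (hc : ∀ v, ∫ u, sDensity τ s (n + 2) u * Lkern τ n u v = c * sDensity τ s (n + 1) v)
    {f : (Fin (n + 1) → ℝ) → ℝ} (hf : Continuous f) (hb : ∃ C : ℝ, ∀ v, |f v| ≤ C) :
    ∫ u, sDensity τ s (n + 2) u * ∫ v, f v * Lkern τ n u v =
      c * ∫ v, sDensity τ s (n + 1) v * f v := by
  obtain ⟨C, hC⟩ := hb
  have hint := (integrable_sDensity_mul_Lkern hτ hs n).bdd_mul (f := fun p => f p.2) (c := C)
    (hf.comp continuous_snd).aestronglyMeasurable (Filter.Eventually.of_forall fun p => hC p.2)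
  have hswap := integral_integral_swap
    (f := fun u v => f v * (sDensity τ s (n + 2) u * Lkern τ n u v)) hint
  simp only [integral_const_mul, hc] at hswap
  rw [← integral_const_mul]
  refine Eq.trans (integral_congr_ae (Filter.Eventually.of_forall fun u => ?_))
    (hswap.trans (integral_congr_ae (Filter.Eventually.of_forall fun v => ?_)))
  · simp only
    rw [← integral_const_mul]
    refine integral_congr_ae (Filter.Eventually.of_forall fun v => ?_)
    simp only
    ring
  · simp only
    ring

open MeasureTheory in
theorem integral_sDensity_succ {τ : ℝ} (hτ : 0 < τ) {s : ℂ} (hs : 1 / 2 < s.re) {n : ℕ}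
    {c : ℝ} (hc : ∀ v, ∫ u, sDensity τ s (n + 2) u * Lkern τ n u v = c * sDensity τ s (n + 1) v) :
    ∫ u, sDensity τ s (n + 2) u = c * ∫ v, sDensity τ s (n + 1) v := by
  have h := integral_sDensity_mul_integral_Lkern hτ hs hc (f := fun _ => 1) continuous_const
    ⟨1, fun _ => by simp⟩
  simp only [one_mul, mul_one] at h
  rw [← h]
  refine integral_congr_ae (Filter.Eventually.of_forall fun u => ?_)
  by_cases hu : StrictAnti u
  · simp only [integral_Lkern hτ hu, mul_one]
  · simp only [sDensity_of_not_strictAnti τ s hu, zero_mul]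

open MeasureTheory in
/-- The Dixon–Anderson kernel is a Markov kernel from `D_N` to `D_{N-1}` (N = n+2 ≥ 2),
and the s-measures satisfy the coherency relation with respect to it. -/
theorem stmt19 (τ : ℝ) (hτ : 0 < τ) (s : ℂ) (hs : 1 / 2 < s.re) (n : ℕ) :
    (∀ u : Fin (n + 2) → ℝ, (∀ i j : Fin (n + 2), i < j → u j < u i) →
      ∫ v : Fin (n + 1) → ℝ, Lkern τ n u v = 1) ∧
    ∀ f : (Fin (n + 1) → ℝ) → ℝ, Continuous f → (∃ C : ℝ, ∀ v, |f v| ≤ C) →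
      ∫ u : Fin (n + 2) → ℝ,
          (∫ v : Fin (n + 1) → ℝ, f v * Lkern τ n u v) ∂(sMeasure τ s (n + 2)) =
        ∫ v : Fin (n + 1) → ℝ, f v ∂(sMeasure τ s (n + 1)) := by
  refine ⟨fun u hu => integral_Lkern hτ fun i j h => hu i j h, fun f hf hb => ?_⟩
  obtain ⟨c, hc0, hc⟩ := exists_integral_sDensity_mul_Lkern hτ hs n
  rw [integral_sMeasure, integral_sMeasure, integral_sDensity_mul_integral_Lkern hτ hs hc hf hb,
    integral_sDensity_succ hτ hs hc, mul_inv, mul_mul_mul_comm, inv_mul_cancel₀ hc0, one_mul]
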